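/- (Trichotomy of adjoints.) Let f* : D → C be a coproduct-preserving tensor-exact functor between rigidly-compactly generated tensor-triangulated categories. Then exactly one of the following three possibilities holds: (1) there are two adjunctions f* ⊣ f_* ⊣ f^(1) and no more (f* has no left adjoint and f^(1) has no right adjoint); (2) there are four adjunctions f_(1) ⊣ f* ⊣ f_* ⊣ f^(1) ⊣ f_(-1) and no more (f_(1) has no left adjoint and f_(-1) has no right adjoint); (3) there is an infinite tower of adjunctions in both directions ⋯ f^(n) ⊣ f_(-n) ⊣ f^(n+1) ⋯ extending f* and f_*. -/

import Mathlib

/-!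
Formalization of statements from "Grothendieck-Neeman duality and the
Wirthmüller isomorphism" by Balmer, Dell'Ambrogio and Sanders.
-/

noncomputable section

open CategoryTheory CategoryTheory.Limits CategoryTheory.Pretriangulated
  CategoryTheory.MonoidalCategory CategoryTheory.MonoidalClosed Opposite

universe v u u₁ u₂ u₃

namespace GN

section Compact

variable {C : Type u} [Category.{v} C]

/-- An object `t` is compact if `Hom(t, -)`, viewed as a functor to abelian groups,
preserves small coproducts. -/
def IsCompactObj [Preadditive C] (t : C) : Prop :=
  ∀ J : Type v, Nonempty (PreservesColimitsOfShape (Discrete J)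
    (preadditiveCoyoneda.obj (op t)))

/-- A functor preserves arbitrary (small) coproducts. -/
def PreservesCoproducts {D : Type u₂} [Category.{v} D] (F : C ⥤ D) : Prop :=
  ∀ J : Type v, Nonempty (PreservesColimitsOfShape (Discrete J) F)

/-- A functor preserves arbitrary (small) products. -/
def PreservesProducts {D : Type u₂} [Category.{v} D] (F : C ⥤ D) : Prop :=
  ∀ J : Type v, Nonempty (PreservesLimitsOfShape (Discrete J) F)

/-- A compactly generated category: it admits all small coproducts and
has a set of compact generators. -/
structure CompactlyGenerated (C : Type u) [Category.{v} C] [Preadditive C] : Prop where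
  hasCoproducts : HasCoproducts.{v} C
  exists_generators : ∃ (ι : Type v) (G : ι → C), (∀ i, IsCompactObj (G i)) ∧
    ∀ t : C, (∀ (i : ι) (f : G i ⟶ t), f = 0) → IsZero t

end Compact

section Tensor

variable {C : Type u} [Category.{v} C] [MonoidalCategory C] [MonoidalClosed C]

/-- The canonical map `hom(x,𝟙) ⊗ y ⟶ hom(x,y)`. -/
def rigidComparison (x y : C) : (ihom x).obj (𝟙_ C) ⊗ y ⟶ (ihom x).obj y :=
  MonoidalClosed.curry ((α_ x ((ihom x).obj (𝟙_ C)) y).inv ≫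
    (((ihom.ev x).app (𝟙_ C)) ▷ y) ≫ (λ_ y).hom)

/-- An object `x` is rigid if `hom(x,𝟙) ⊗ y ⟶ hom(x,y)` is an isomorphism for all `y`. -/
def IsRigid (x : C) : Prop := ∀ y : C, IsIso (rigidComparison x y)

/-- An object `u` is `⊗`-invertible if `u ⊗ v ≅ 𝟙` for some `v`. -/
def TensorInvertible (u : C) : Prop := ∃ v : C, Nonempty (u ⊗ v ≅ 𝟙_ C)

/-- The `κ`-twisted duality functor `D_κ = hom(-,κ)`. -/
@[reducible] def Dfun (κ : C) : Cᵒᵖ ⥤ C := MonoidalClosed.internalHom.flip.obj κ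

/-- The canonical double-duality map `ϖ : x ⟶ D_κ D_κ (x)`, i.e. the unit/counit of the
self-adjunction of `D_κ = hom(-,κ)`. -/
def varpi [BraidedCategory C] (κ x : C) : x ⟶ (ihom ((ihom x).obj κ)).obj κ :=
  MonoidalClosed.curry ((β_ ((ihom x).obj κ) x).hom ≫ (ihom.ev x).app κ)

/-- A rigidly-compactly generated tensor-triangulated category: it admits all small
coproducts, its compact objects coincide with its rigid objects, and it has a set of
compact generators. -/
structure RigidlyCompactlyGenerated (C : Type u) [Category.{v} C] [Preadditive C]
    [MonoidalCategory C] [MonoidalClosed C] : Prop where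
  hasCoproducts : HasCoproducts.{v} C
  compact_iff_rigid : ∀ x : C, IsCompactObj x ↔ IsRigid x
  exists_generators : ∃ (ι : Type v) (G : ι → C), (∀ i, IsCompactObj (G i)) ∧
    ∀ t : C, (∀ (i : ι) (f : G i ⟶ t), f = 0) → IsZero t

end Tensor

section Triang

variable {C : Type u} [Category.{v} C] [HasZeroObject C] [Preadditive C] [HasShift C ℤ]
  [∀ n : ℤ, (shiftFunctor C n).Additive] [Pretriangulated C]

/-- A thick triangulated subcategory, given as a predicate on objects:
it contains the zero objects, and is closed under shifts, cones and direct summands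
(hence in particular under isomorphisms). -/
structure IsThickSubcategory (S : Set C) : Prop where
  zero : ∀ x : C, IsZero x → x ∈ S
  shift : ∀ x ∈ S, ∀ n : ℤ, x⟦n⟧ ∈ S
  ext₃ : ∀ T : Triangle C, (T ∈ distTriang C) → T.obj₁ ∈ S → T.obj₂ ∈ S → T.obj₃ ∈ S
  retract : ∀ x y : C, (∃ (s : x ⟶ y) (r : y ⟶ x), s ≫ r = 𝟙 x) → y ∈ S → x ∈ S

/-- The thick subcategory generated by a set of objects. -/
def thickClosure (S : Set C) : Set C :=
  { x | ∀ T : Set C, IsThickSubcategory T → S ⊆ T → x ∈ T }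

/-- A `C^c`-submodule of `C`: a thick triangulated subcategory which is closed under
tensoring with compact objects. -/
structure IsSubmodule [MonoidalCategory C] (S : Set C) extends IsThickSubcategory S : Prop where
  smul : ∀ c x : C, IsCompactObj c → x ∈ S → (c ⊗ x) ∈ S

end Triang

section Dual

variable {C : Type u} [Category.{v} C] [MonoidalCategory C] [BraidedCategory C]
  [MonoidalClosed C]

/-- `κ` is a (possibly external) dualizing object for `S ⊆ C`: the `κ`-twisted
duality `D_κ = hom(-,κ)` preserves `S` and every object of `S` is `κ`-reflexive;
equivalently, `D_κ` restricts to an anti-equivalence `S^op ≃ S`. -/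
structure IsExternalDualizing (S : Set C) (κ : C) : Prop where
  stable : ∀ x ∈ S, (ihom x).obj κ ∈ S
  reflexive : ∀ x ∈ S, IsIso (varpi κ x)

/-- `κ ∈ S` is a dualizing object for `S`. -/
structure IsDualizing (S : Set C) (κ : C) extends IsExternalDualizing S κ : Prop where
  mem : κ ∈ S

end Dual

section Pullback

variable {C : Type u₁} {D : Type u₂} [Category.{v} C] [Category.{v} D]
  [Preadditive C] [MonoidalCategory C]

/-- The compact pull-back `f^#(D₀)` of a subcategory `D₀ ⊆ D` along `f_* : C ⥤ D`. -/
def compactPullback (fpush : C ⥤ D) (D₀ : Set D) : Set C :=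
  { x | ∀ c : C, IsCompactObj c → fpush.obj (c ⊗ x) ∈ D₀ }

end Pullback

section Proj

variable {D : Type u₁} {C : Type u₂} [Category.{v} D] [Category.{v} C]
  [MonoidalCategory D] [MonoidalCategory C]

/-- The canonical projection formula map `π : x ⊗ f_*(y) ⟶ f_*(f^*(x) ⊗ y)`,
obtained by adjunction from `f^*(x ⊗ f_* y) ≅ f^* x ⊗ f^* f_* y → f^* x ⊗ y`. -/
def projFormula (fstar : D ⥤ C) [fstar.Monoidal] (fpush : C ⥤ D) (adj : fstar ⊣ fpush)
    (x : D) (y : C) : x ⊗ fpush.obj y ⟶ fpush.obj (fstar.obj x ⊗ y) :=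
  (adj.homEquiv _ _)
    (Functor.OplaxMonoidal.δ fstar x (fpush.obj y) ≫ (fstar.obj x ◁ adj.counit.app y))

/-- The canonical comparison map `f^(1)(x) ⊗ f^*(y) ⟶ f^(1)(x ⊗ y)`, obtained by
adjunction from the counit `f_* f^(1) → Id` via the projection formula. -/
def gnComparison [BraidedCategory D] [BraidedCategory C] (fstar : D ⥤ C) [fstar.Monoidal]
    (fpush : C ⥤ D) (adj1 : fstar ⊣ fpush) (fone : D ⥤ C) (adj2 : fpush ⊣ fone)
    (hπ : ∀ (x : D) (y : C), IsIso (projFormula fstar fpush adj1 x y)) (x y : D) :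
    fone.obj x ⊗ fstar.obj y ⟶ fone.obj (x ⊗ y) :=
  haveI := hπ y (fone.obj x)
  (adj2.homEquiv _ _)
    (fpush.map (β_ (fone.obj x) (fstar.obj y)).hom ≫
      inv (projFormula fstar fpush adj1 y (fone.obj x)) ≫
      (β_ y (fpush.obj (fone.obj x))).hom ≫ (adj2.counit.app x ▷ y))

end Proj

section CompactObjects

variable {C : Type u₁} [Category.{v} C] [Preadditive C] [HasCoproducts.{v} C]
  {D : Type u₂} [Category.{v} D] [Preadditive D] [HasCoproducts.{v} D]

lemma comp_sigmaπ_of_eq_sum {t : C} {J : Type v} [DecidableEq J] {Y : J → C} {f : t ⟶ ∐ Y}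
    {s : Finset J} {g : ∀ j, t ⟶ Y j} (hs : f = ∑ j ∈ s, g j ≫ Sigma.ι Y j) (j : J) :
    f ≫ Sigma.π Y j = if j ∈ s then g j else 0 := by
  rw [hs, Preadditive.sum_comp]
  split_ifs with h
  · rw [Finset.sum_eq_single_of_mem j h]
    · simp
    · intro i _ hij
      simp [Sigma.ι_π_of_ne _ hij]
  · refine Finset.sum_eq_zero fun i hi => ?_
    have hij : i ≠ j := fun e => h (e ▸ hi)
    simp [Sigma.ι_π_of_ne _ hij]

/-- A compact object maps into a coproduct through finitely many summands. -/
lemma IsCompactObj.exists_finset {t : C} (ht : IsCompactObj t) {J : Type v} {Y : J → C}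
    (f : t ⟶ ∐ Y) : ∃ (s : Finset J) (g : ∀ j, t ⟶ Y j), f = ∑ j ∈ s, g j ≫ Sigma.ι Y j := by
  classical
  obtain ⟨_⟩ := ht J
  let A : AddSubgroup (t ⟶ ∐ Y) :=
    { carrier := { f | ∃ (s : Finset J) (g : ∀ j, t ⟶ Y j), f = ∑ j ∈ s, g j ≫ Sigma.ι Y j }
      zero_mem' := ⟨∅, fun _ => 0, by simp⟩
      add_mem' := by
        rintro a b ⟨s, g, hs⟩ ⟨s', g', hs'⟩
        refine ⟨s ∪ s', fun j => (if j ∈ s then g j else 0) + if j ∈ s' then g' j else 0, ?_⟩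
        simp only [Preadditive.add_comp, Finset.sum_add_distrib]
        rw [hs, hs']
        congr 1
        · rw [← Finset.sum_subset (Finset.subset_union_left (s₁ := s) (s₂ := s'))]
          · exact Finset.sum_congr rfl fun j hj => by simp [hj]
          · intro j _ hj
            simp [hj]
        · rw [← Finset.sum_subset (Finset.subset_union_right (s₁ := s) (s₂ := s'))]
          · exact Finset.sum_congr rfl fun j hj => by simp [hj]
          · intro j _ hj
            simp [hj]
      neg_mem' := by
        rintro a ⟨s, g, hs⟩
        exact ⟨s, fun j => - g j, by simp [hs]⟩ }
  have hc := isColimitOfPreserves (preadditiveCoyoneda.obj (op t)) (coproductIsCoproduct Y)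
  have key : AddCommGrpCat.ofHom (QuotientAddGroup.mk' A) =
      (0 : AddCommGrpCat.of (t ⟶ ∐ Y) ⟶ AddCommGrpCat.of ((t ⟶ ∐ Y) ⧸ A)) := by
    refine hc.hom_ext ?_
    rintro ⟨j⟩
    ext (g : t ⟶ Y j)
    refine (QuotientAddGroup.eq_zero_iff (g ≫ Sigma.ι Y j)).2 ?_
    exact ⟨{j}, fun i => if h : j = i then g ≫ eqToHom (by rw [h]) else 0, by simp⟩
  have h0 : QuotientAddGroup.mk' A f = 0 :=
    congrArg (fun k => (AddCommGrpCat.Hom.hom k) f) key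
  exact (QuotientAddGroup.eq_zero_iff f).1 h0

lemma isCompactObj_of_exists_finset {t : C}
    (ht : ∀ (J : Type v) (Y : J → C) (f : t ⟶ ∐ Y),
      ∃ (s : Finset J) (g : ∀ j, t ⟶ Y j), f = ∑ j ∈ s, g j ≫ Sigma.ι Y j) :
    IsCompactObj t := by
  classical
  intro J
  have : ∀ Y : J → C, PreservesColimit (Discrete.functor Y) (preadditiveCoyoneda.obj (op t)) := by
    intro Y
    refine preservesColimit_of_preserves_colimit_cocone (coproductIsCoproduct Y) ?_
    let φ : ∀ (s : Cocone (Discrete.functor Y ⋙ preadditiveCoyoneda.obj (op t))) (j : J),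
        (t ⟶ Y j) →+ s.pt := fun s j => (s.ι.app ⟨j⟩).hom
    have hsupp : ∀ (s : Cocone (Discrete.functor Y ⋙ preadditiveCoyoneda.obj (op t)))
        (f : t ⟶ ∐ Y), (Function.support fun j => φ s j (f ≫ Sigma.π Y j)).Finite := by
      intro s f
      obtain ⟨S, g, hS⟩ := ht J Y f
      refine S.finite_toSet.subset fun j hj => ?_
      by_contra hjs
      refine hj ?_
      have : f ≫ Sigma.π Y j = 0 := (comp_sigmaπ_of_eq_sum hS j).trans (if_neg hjs)
      simp [this]
    let ψ : ∀ (s : Cocone (Discrete.functor Y ⋙ preadditiveCoyoneda.obj (op t))),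
        (t ⟶ ∐ Y) →+ s.pt := fun s =>
      { toFun := fun f => ∑ᶠ j, φ s j (f ≫ Sigma.π Y j)
        map_zero' := by simp
        map_add' := fun f g => by
          rw [← finsum_add_distrib (hsupp s f) (hsupp s g)]
          simp }
    refine
      { desc := fun s => AddCommGrpCat.ofHom (ψ s)
        fac := ?_
        uniq := ?_ }
    · rintro s ⟨j⟩
      ext (g : t ⟶ Y j)
      change ∑ᶠ i, φ s i ((g ≫ Sigma.ι Y j) ≫ Sigma.π Y i) = φ s j g
      rw [finsum_eq_single _ j]
      · simp
      · intro i hi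
        simp [Sigma.ι_π_of_ne _ hi.symm]
    · intro s m hm
      ext (f : t ⟶ ∐ Y)
      let m' : (t ⟶ ∐ Y) →+ s.pt := m.hom
      change m' f = ψ s f
      have h1 : ∀ j (g : t ⟶ Y j), m' (g ≫ Sigma.ι Y j) = φ s j g := fun j g =>
        congrArg (fun k => (AddCommGrpCat.Hom.hom k) g) (hm ⟨j⟩)
      have h2 : ∀ j (g : t ⟶ Y j), ψ s (g ≫ Sigma.ι Y j) = φ s j g := fun j g => by
        change ∑ᶠ i, φ s i ((g ≫ Sigma.ι Y j) ≫ Sigma.π Y i) = φ s j g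
        rw [finsum_eq_single _ j]
        · simp
        · intro i hi
          simp [Sigma.ι_π_of_ne _ hi.symm]
      obtain ⟨S, g, hS⟩ := ht J Y f
      rw [hS, map_sum, map_sum]
      exact Finset.sum_congr rfl fun j _ => (h1 j _).trans (h2 j _).symm
  exact ⟨preservesColimitsOfShape_of_discrete _⟩

/-- A left adjoint whose right adjoint preserves coproducts preserves compact objects. -/
lemma IsCompactObj.of_adjunction {L : C ⥤ D} {R : D ⥤ C} (adj : L ⊣ R) [R.Additive]
    (hR : PreservesCoproducts R) {t : C} (ht : IsCompactObj t) : IsCompactObj (L.obj t) := by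
  refine isCompactObj_of_exists_finset fun J Y f => ?_
  obtain ⟨_⟩ := hR J
  have : L.Additive := adj.left_adjoint_additive
  obtain ⟨s, g, hs⟩ := ht.exists_finset
    ((adj.homEquiv _ _ f) ≫ inv (sigmaComparison R Y))
  refine ⟨s, fun j => (adj.homEquiv _ _).symm (g j), (adj.homEquiv _ _).injective ?_⟩
  rw [IsIso.comp_inv_eq, Preadditive.sum_comp] at hs
  rw [hs, ← adj.homAddEquiv_apply, map_sum]
  refine Finset.sum_congr rfl fun j _ => ?_
  simp [adj.homEquiv_naturality_right]

omit [HasCoproducts.{v} C] in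
lemma IsCompactObj.of_iso {t t' : C} (e : t ≅ t') (ht : IsCompactObj t) : IsCompactObj t' := by
  intro J
  obtain ⟨_⟩ := ht J
  exact ⟨preservesColimitsOfShape_of_natIso (preadditiveCoyoneda.mapIso e.op.symm)⟩

omit [Preadditive C] [HasCoproducts.{v} C] [Preadditive D] [HasCoproducts.{v} D] in
lemma preservesCoproducts_of_isLeftAdjoint (F : C ⥤ D) [F.IsLeftAdjoint] :
    PreservesCoproducts F := fun _ => ⟨inferInstance⟩

end CompactObjects

section Triangulated

variable {C : Type u₁} [Category.{v} C] [Preadditive C] [HasZeroObject C] [HasShift C ℤ]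
  [∀ n : ℤ, (shiftFunctor C n).Additive] [Pretriangulated C] [HasCoproducts.{v} C]
  {D : Type u₂} [Category.{v} D] [Preadditive D] [HasCoproducts.{v} D]

omit [HasZeroObject C] [Pretriangulated C] in
lemma IsCompactObj.shift {t : C} (ht : IsCompactObj t) (n : ℤ) : IsCompactObj (t⟦n⟧) := by
  have : (shiftEquiv C n).inverse.Additive := inferInstanceAs (shiftFunctor C (-n)).Additive
  exact ht.of_adjunction (shiftEquiv C n).toAdjunction
    (preservesCoproducts_of_isLeftAdjoint (shiftEquiv C n).inverse)

/-- There is a set of compact objects detecting the vanishing of objects. -/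
def HasCompactGenerators (C : Type u) [Category.{v} C] [Preadditive C] : Prop :=
  ∃ (ι : Type v) (G : ι → C), (∀ i, IsCompactObj (G i)) ∧
    ∀ t : C, (∀ (i : ι) (f : G i ⟶ t), f = 0) → IsZero t

omit [HasCoproducts.{v} C] in
lemma exists_lift_of_distTriang {X Y Z : C} {f : X ⟶ Y} {g : Y ⟶ Z} {h : Z ⟶ X⟦(1 : ℤ)⟧}
    (hT : Triangle.mk f g h ∈ distTriang C) {W : C} (k : W ⟶ Y) (hk : k ≫ g = 0) :
    ∃ l : W ⟶ X, k = l ≫ f := Triangle.coyoneda_exact₂ _ hT k hk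

omit [HasCoproducts.{v} C] in
lemma exists_lift₃_of_distTriang {X Y Z : C} {f : X ⟶ Y} {g : Y ⟶ Z} {h : Z ⟶ X⟦(1 : ℤ)⟧}
    (hT : Triangle.mk f g h ∈ distTriang C) {W : C} (k : W ⟶ Z) (hk : k ≫ h = 0) :
    ∃ l : W ⟶ Y, k = l ≫ g := Triangle.coyoneda_exact₃ _ hT k hk

omit [HasCoproducts.{v} C] in
lemma exists_desc_of_distTriang {X Y Z : C} {f : X ⟶ Y} {g : Y ⟶ Z} {h : Z ⟶ X⟦(1 : ℤ)⟧}
    (hT : Triangle.mk f g h ∈ distTriang C) {W : C} (k : Y ⟶ W) (hk : f ≫ k = 0) :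
    ∃ l : Z ⟶ W, k = g ≫ l := Triangle.yoneda_exact₂ _ hT k hk

omit [HasCoproducts.{v} C] [HasZeroObject C] [Pretriangulated C] in
lemma comp_shift_eq_zero {W X Y : C} (φ : X ⟶ Y)
    (h : ∀ g : W⟦(-1 : ℤ)⟧ ⟶ X, g ≫ φ = 0 → g = 0) (k : W ⟶ X⟦(1 : ℤ)⟧)
    (hk : k ≫ φ⟦(1 : ℤ)⟧' = 0) : k = 0 := by
  let e : (W⟦(-1 : ℤ)⟧)⟦(1 : ℤ)⟧ ≅ W :=
    (shiftFunctorCompIsoId C (-1 : ℤ) 1 (by simp)).app W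
  obtain ⟨k', hk'⟩ := (shiftFunctor C (1 : ℤ)).map_surjective (e.hom ≫ k)
  have h0 : k' = 0 := h k' <| (shiftFunctor C (1 : ℤ)).map_injective <| by
    rw [Functor.map_comp, hk', Category.assoc, hk, comp_zero, Functor.map_zero]
  rw [h0, Functor.map_zero] at hk'
  rw [← cancel_epi e.hom, ← hk', comp_zero]

/-- In a compactly generated triangulated category, compact objects detect isomorphisms. -/
lemma isIso_of_bijective_of_isCompactObj (hC : HasCompactGenerators C) {X Y : C} (φ : X ⟶ Y)
    (h : ∀ c : C, IsCompactObj c → Function.Bijective fun g : c ⟶ X => g ≫ φ) : IsIso φ := by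
  obtain ⟨ι, G, hG, hG'⟩ := hC
  obtain ⟨Z, a, b, hT⟩ := distinguished_cocone_triangle φ
  have hZ : IsZero Z := hG' _ fun i f => by
    have h1 : f ≫ b = 0 := by
      refine comp_shift_eq_zero φ (fun g hg => ?_) _ ?_
      · exact (h _ ((hG i).shift (-1))).1 (hg.trans zero_comp.symm)
      · rw [Category.assoc, show b ≫ φ⟦(1 : ℤ)⟧' = 0 from comp_distTriang_mor_zero₃₁ _ hT,
          comp_zero]
    obtain ⟨g, hg⟩ := exists_lift₃_of_distTriang hT f h1
    obtain ⟨k, hk⟩ := (h _ (hG i)).2 g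
    change k ≫ φ = g at hk
    rw [hg, ← hk, Category.assoc, show φ ≫ a = 0 from comp_distTriang_mor_zero₁₂ _ hT, comp_zero]
  exact (Triangle.isZero₃_iff_isIso₁ _ hT).1 hZ

/-- A right adjoint whose left adjoint preserves compact objects preserves coproducts. -/
lemma preservesCoproducts_of_adjunction (hC : HasCompactGenerators C) {L : C ⥤ D} {R : D ⥤ C}
    (adj : L ⊣ R) [R.Additive] (hL : ∀ t : C, IsCompactObj t → IsCompactObj (L.obj t)) :
    PreservesCoproducts R := by
  classical
  intro J
  have : L.Additive := adj.left_adjoint_additive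
  have key : ∀ Y : J → D, IsIso (sigmaComparison R Y) := by
    intro Y
    have h3 : ∀ j, sigmaComparison R Y ≫ R.map (Sigma.π Y j) =
        Sigma.π (fun j => R.obj (Y j)) j := by
      intro j
      refine Sigma.hom_ext _ _ fun i => ?_
      by_cases hij : i = j
      · subst hij
        simp [← R.map_comp]
      · simp [Sigma.ι_π_of_ne _ hij, ← R.map_comp]
    refine isIso_of_bijective_of_isCompactObj hC _ fun c hc => ⟨?_, ?_⟩
    · refine (injective_iff_map_eq_zero
        (Preadditive.rightComp c (sigmaComparison R Y))).2 fun g hg => ?_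
      change g ≫ sigmaComparison R Y = 0 at hg
      obtain ⟨s, g', hs⟩ := hc.exists_finset g
      rw [hs]
      refine Finset.sum_eq_zero fun j hj => ?_
      have h4 := (comp_sigmaπ_of_eq_sum hs j).trans (if_pos hj)
      rw [← h3, reassoc_of% hg, zero_comp] at h4
      rw [← h4, zero_comp]
    · intro g
      obtain ⟨s, g', hs⟩ := (hL c hc).exists_finset ((adj.homEquiv _ _).symm g)
      refine ⟨∑ j ∈ s, adj.homEquiv _ _ (g' j) ≫ Sigma.ι (fun j => R.obj (Y j)) j, ?_⟩
      apply_fun adj.homAddEquiv _ _ at hs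
      rw [map_sum] at hs
      simp only [adj.homAddEquiv_apply, Equiv.apply_symm_apply,
        adj.homEquiv_naturality_right] at hs
      simp only [Preadditive.sum_comp, Category.assoc, ι_comp_sigmaComparison]
      exact hs.symm
  have : ∀ Y : J → D, PreservesColimit (Discrete.functor Y) R := fun Y =>
    have := key Y
    PreservesCoproduct.of_iso_comparison R Y
  exact ⟨preservesColimitsOfShape_of_discrete _⟩

end Triangulated

set_option linter.unusedSectionVars false

section Localizing

variable {D : Type u₁} [Category.{v} D] [Preadditive D] [HasZeroObject D] [HasShift D ℤ]
  [∀ n : ℤ, (shiftFunctor D n).Additive] [Pretriangulated D] [HasCoproducts.{v} D]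

/-- A property of objects defining a localizing subcategory. -/
structure IsLocalizing (P : D → Prop) : Prop where
  of_iso : ∀ {X Y : D}, (X ≅ Y) → P X → P Y
  shift : ∀ {X : D}, P X → ∀ n : ℤ, P (X⟦n⟧)
  cone : ∀ {X Y Z : D} {f : X ⟶ Y} {g : Y ⟶ Z} {h : Z ⟶ X⟦(1 : ℤ)⟧},
    Triangle.mk f g h ∈ distTriang D → P X → P Y → P Z
  sigma : ∀ {J : Type v} {Y : J → D}, (∀ j, P (Y j)) → P (∐ Y)

/-- The localizing subcategory generated by a family of objects. -/
def localizingClosure {I : Type v} (S : I → D) (X : D) : Prop :=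
  ∀ P : D → Prop, IsLocalizing P → (∀ i, P (S i)) → P X

lemma isLocalizing_localizingClosure {I : Type v} (S : I → D) :
    IsLocalizing (localizingClosure S) where
  of_iso e h P hP hS := hP.of_iso e (h P hP hS)
  shift h n P hP hS := hP.shift (h P hP hS) n
  cone hT h h' P hP hS := hP.cone hT (h P hP hS) (h' P hP hS)
  sigma h P hP hS := hP.sigma fun j => h j P hP hS

lemma mem_localizingClosure {I : Type v} (S : I → D) (i : I) : localizingClosure S (S i) :=
  fun _ _ hS => hS i

variable {C : Type u₂} [Category.{v} C] [Preadditive C] [HasZeroObject C] [HasShift C ℤ]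
  [∀ n : ℤ, (shiftFunctor C n).Additive] [Pretriangulated C]

omit [Preadditive D] [HasZeroObject D] [HasShift D ℤ]
  [∀ n : ℤ, (shiftFunctor D n).Additive] [Pretriangulated D] [Preadditive C] [HasZeroObject C] [HasShift C ℤ]
  [∀ n : ℤ, (shiftFunctor C n).Additive] [Pretriangulated C] in
lemma map_sigma_hom_ext {F : D ⥤ C} (hF : PreservesCoproducts F) {J : Type v} {Y : J → D}
    {y : C} {a b : F.obj (∐ Y) ⟶ y}
    (h : ∀ j, F.map (Sigma.ι Y j) ≫ a = F.map (Sigma.ι Y j) ≫ b) : a = b := by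
  obtain ⟨_⟩ := hF J
  exact (isColimitOfPreserves F (coproductIsCoproduct Y)).hom_ext fun ⟨j⟩ => h j

omit [Preadditive D] [HasZeroObject D] [HasShift D ℤ]
  [∀ n : ℤ, (shiftFunctor D n).Additive] [Pretriangulated D] [Preadditive C] [HasZeroObject C] [HasShift C ℤ]
  [∀ n : ℤ, (shiftFunctor C n).Additive] [Pretriangulated C] in
lemma exists_map_sigma_desc {F : D ⥤ C} (hF : PreservesCoproducts F) {J : Type v} {Y : J → D}
    {y : C} (e : ∀ j, F.obj (Y j) ⟶ y) :
    ∃ a : F.obj (∐ Y) ⟶ y, ∀ j, F.map (Sigma.ι Y j) ≫ a = e j := by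
  obtain ⟨_⟩ := hF J
  let c : Cocone (Discrete.functor Y ⋙ F) := ⟨y, Discrete.natTrans fun ⟨j⟩ => e j⟩
  exact ⟨(isColimitOfPreserves F (coproductIsCoproduct Y)).desc c, fun j =>
    (isColimitOfPreserves F (coproductIsCoproduct Y)).fac c ⟨j⟩⟩

lemma exists_map_cone_desc (F : D ⥤ C) [F.CommShift ℤ] [F.IsTriangulated]
    {X Y Z : D} {f : X ⟶ Y} {g : Y ⟶ Z} {h : Z ⟶ X⟦(1 : ℤ)⟧}
    (hT : Triangle.mk f g h ∈ distTriang D) {y : C} (e : F.obj Y ⟶ y)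
    (he : F.map f ≫ e = 0) : ∃ e' : F.obj Z ⟶ y, e = F.map g ≫ e' :=
  exists_desc_of_distTriang (F.map_distinguished _ hT) e he

/-- An object over `y` along `F` built from the family `S`. -/
structure Approx {I : Type v} (S : I → D) (F : D ⥤ C) (y : C) where
  obj : D
  hom : F.obj obj ⟶ y
  mem : localizingClosure S obj

variable {I : Type v} (S : I → D) (F : D ⥤ C) [F.CommShift ℤ] [F.IsTriangulated]
  (hF : PreservesCoproducts F) (y : C)

include hF in
omit [F.CommShift ℤ] [F.IsTriangulated] in
lemma exists_approx_surjective : ∃ A : Approx S F y, ∀ i (φ : F.obj (S i) ⟶ y),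
    ∃ g : S i ⟶ A.obj, F.map g ≫ A.hom = φ := by
  let Y : (Σ i, (F.obj (S i) ⟶ y)) → D := fun j => S j.1
  obtain ⟨e, he⟩ := exists_map_sigma_desc hF (Y := Y) (fun j => j.2)
  exact ⟨⟨∐ Y, e, (isLocalizing_localizingClosure S).sigma fun j => mem_localizingClosure S j.1⟩,
    fun i φ => ⟨Sigma.ι Y ⟨i, φ⟩, he _⟩⟩

include hF in
lemma exists_approx_succ (A : Approx S F y) : ∃ (B : Approx S F y) (j : A.obj ⟶ B.obj),
    F.map j ≫ B.hom = A.hom ∧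
      ∀ i (ψ : S i ⟶ A.obj), F.map ψ ≫ A.hom = 0 → ψ ≫ j = 0 := by
  let K := Σ i, {ψ : S i ⟶ A.obj // F.map ψ ≫ A.hom = 0}
  let Y : K → D := fun j => S j.1
  let s : ∐ Y ⟶ A.obj := Sigma.desc fun j => j.2.1
  obtain ⟨Z, j, h, hT⟩ := distinguished_cocone_triangle s
  have hs : F.map s ≫ A.hom = 0 := map_sigma_hom_ext hF fun k => by
    rw [← F.map_comp_assoc, Sigma.ι_desc, k.2.2, comp_zero]
  obtain ⟨e', he'⟩ := exists_map_cone_desc F hT A.hom hs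
  refine ⟨⟨Z, e', (isLocalizing_localizingClosure S).cone hT
    ((isLocalizing_localizingClosure S).sigma fun j => mem_localizingClosure S j.1) A.mem⟩,
    j, he'.symm, fun i ψ hψ => ?_⟩
  have h1 : s ≫ j = 0 := comp_distTriang_mor_zero₁₂ _ hT
  have h2 : Sigma.ι Y ⟨i, ψ, hψ⟩ ≫ s = ψ := Sigma.ι_desc _ _
  rw [← h2, Category.assoc]
  exact (congrArg _ h1).trans comp_zero

section Telescope

variable {Y : ℕ → D} (j : ∀ n, Y n ⟶ Y (n + 1))

/-- The coproduct of the terms of a sequence. -/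
abbrev seqSigma (Y : ℕ → D) : D := ∐ fun n : ULift.{v} ℕ => Y n.down

/-- The inclusion of a term of a sequence. -/
abbrev seqι (Y : ℕ → D) (n : ℕ) : Y n ⟶ seqSigma Y :=
  Sigma.ι (fun n : ULift.{v} ℕ => Y n.down) ⟨n⟩

/-- The shift endomorphism of the coproduct of the terms of a sequence. -/
def seqShift : seqSigma Y ⟶ seqSigma Y :=
  Sigma.desc fun n => j n.down ≫ seqι Y (n.down + 1)

omit [Preadditive D] [HasZeroObject D] [HasShift D ℤ]
  [∀ n : ℤ, (shiftFunctor D n).Additive] [Pretriangulated D] in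
lemma seqι_seqShift (n : ℕ) : seqι Y n ≫ seqShift j = j n ≫ seqι Y (n + 1) :=
  Sigma.ι_desc _ _

omit [Preadditive D] [HasZeroObject D] [HasShift D ℤ]
  [∀ n : ℤ, (shiftFunctor D n).Additive] [Pretriangulated D] in
lemma seqι_seqShift_assoc (n : ℕ) {Z : D} (h : seqSigma Y ⟶ Z) :
    seqι Y n ≫ seqShift j ≫ h = j n ≫ seqι Y (n + 1) ≫ h := by
  rw [← Category.assoc, seqι_seqShift, Category.assoc]

omit [HasZeroObject D] [HasShift D ℤ]
  [∀ n : ℤ, (shiftFunctor D n).Additive] [Pretriangulated D] in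
lemma eq_zero_of_comp_one_sub_seqShift {t : D} (ht : IsCompactObj t) (g : t ⟶ seqSigma Y)
    (hg : g ≫ (𝟙 _ - seqShift j) = 0) : g = 0 := by
  classical
  have hg' : g = g ≫ seqShift j := by
    rw [Preadditive.comp_sub, Category.comp_id, sub_eq_zero] at hg
    exact hg
  let p (n : ℕ) : seqSigma Y ⟶ Y n := Sigma.π (fun n : ULift.{v} ℕ => Y n.down) ⟨n⟩
  have hp1 : ∀ n, seqι Y n ≫ p n = 𝟙 _ := fun n => Sigma.ι_π_eq_id _ _
  have hp2 : ∀ m n, m ≠ n → seqι Y m ≫ p n = 0 := fun m n hmn =>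
    Sigma.ι_π_of_ne (fun n : ULift.{v} ℕ => Y n.down) (fun e => hmn (congrArg ULift.down e))
  have h0 : seqShift j ≫ p 0 = 0 := Sigma.hom_ext _ _ fun n => by
    change seqι Y n.down ≫ _ = seqι Y n.down ≫ _
    rw [seqι_seqShift_assoc, hp2 _ _ (by simp), comp_zero, comp_zero]
  have h1 : ∀ n, seqShift j ≫ p (n + 1) = p n ≫ j n := fun n => Sigma.hom_ext _ _ fun m => by
    change seqι Y m.down ≫ _ = seqι Y m.down ≫ _
    rw [seqι_seqShift_assoc]
    by_cases hmn : m.down = n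
    · subst hmn
      rw [hp1, reassoc_of% (hp1 m.down), Category.comp_id]
    · rw [hp2 _ _ (by simpa using hmn), comp_zero, ← Category.assoc, hp2 _ _ hmn, zero_comp]
  have h2 : ∀ n, g ≫ p n = 0 := by
    intro n
    induction n with
    | zero => rw [hg', Category.assoc, h0, comp_zero]
    | succ n ih => rw [hg', Category.assoc, h1, reassoc_of% ih, zero_comp]
  obtain ⟨s, g', hs⟩ := ht.exists_finset g
  rw [hs]
  refine Finset.sum_eq_zero fun n hn => ?_
  have h3 := (comp_sigmaπ_of_eq_sum hs n).trans (if_pos hn)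
  rw [← h3]
  exact (congrArg (· ≫ _) (h2 n.down)).trans zero_comp

omit [HasZeroObject D] [HasShift D ℤ]
  [∀ n : ℤ, (shiftFunctor D n).Additive] [Pretriangulated D] in
lemma exists_factor_seqι {t : D} (ht : IsCompactObj t) {Z : D} (a : seqSigma Y ⟶ Z)
    (ha : ∀ n, j n ≫ seqι Y (n + 1) ≫ a = seqι Y n ≫ a) (l : t ⟶ seqSigma Y) :
    ∃ (n : ℕ) (g : t ⟶ Y n), l ≫ a = g ≫ seqι Y n ≫ a := by
  have raise : ∀ (n m : ℕ) (g : t ⟶ Y n), ∃ g' : t ⟶ Y (n + m),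
      g ≫ seqι Y n ≫ a = g' ≫ seqι Y (n + m) ≫ a := by
    intro n m g
    induction m with
    | zero => exact ⟨g, rfl⟩
    | succ m ih =>
      obtain ⟨g', hg'⟩ := ih
      refine ⟨g' ≫ j (n + m), ?_⟩
      rw [hg', Category.assoc]
      exact (congrArg _ (ha (n + m))).symm
  obtain ⟨s, g, rfl⟩ := ht.exists_finset l
  rw [Preadditive.sum_comp]
  induction s using Finset.cons_induction with
  | empty => exact ⟨0, 0, by simp⟩
  | cons k s hk ih =>
    obtain ⟨n, g1, h1⟩ := ih
    have raise' : ∀ (n m : ℕ) (_ : n ≤ m) (g : t ⟶ Y n), ∃ g' : t ⟶ Y m,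
        g ≫ seqι Y n ≫ a = g' ≫ seqι Y m ≫ a := by
      intro n m hnm g
      obtain ⟨r, rfl⟩ := Nat.exists_eq_add_of_le hnm
      exact raise n r g
    obtain ⟨g2, h2⟩ := raise' n (max n k.down) (le_max_left _ _) g1
    obtain ⟨g3, h3⟩ := raise' k.down (max n k.down) (le_max_right _ _) (g k)
    refine ⟨max n k.down, g3 + g2, ?_⟩
    rw [Finset.sum_cons, h1, Preadditive.add_comp, ← h2, ← h3, Category.assoc]

end Telescope

include hF in
/-- Approximation of `y` along `F` by an object of the localizing subcategory generated by the
compact objects `S i`. -/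
lemma exists_approx_bijective (hS : ∀ i, IsCompactObj (S i)) :
    ∃ A : Approx S F y, ∀ i, Function.Bijective fun g : S i ⟶ A.obj => F.map g ≫ A.hom := by
  obtain ⟨A₀, hA₀⟩ := exists_approx_surjective S F hF y
  choose next j hj hj' using exists_approx_succ S F hF y
  let A (n : ℕ) : Approx S F y := Nat.rec A₀ (fun _ A => next A) n
  let Y (n : ℕ) : D := (A n).obj
  let e (n : ℕ) : F.obj (Y n) ⟶ y := (A n).hom
  let q (n : ℕ) : Y n ⟶ Y (n + 1) := j (A n)
  have hq : ∀ n, F.map (q n) ≫ e (n + 1) = e n := fun n => hj (A n)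
  have hq' : ∀ n i (ψ : S i ⟶ Y n), F.map ψ ≫ e n = 0 → ψ ≫ q n = 0 := fun n => hj' (A n)
  obtain ⟨Z, a, b, hT⟩ := distinguished_cocone_triangle (𝟙 (seqSigma Y) - seqShift q)
  obtain ⟨eW, heW⟩ := exists_map_sigma_desc hF (Y := fun n : ULift.{v} ℕ => Y n.down)
    (fun n => e n.down)
  have heW' : ∀ n, F.map (seqι Y n) ≫ eW = e n := fun n => heW ⟨n⟩
  have h1 : F.map (𝟙 (seqSigma Y) - seqShift q) ≫ eW = 0 := map_sigma_hom_ext hF fun n => by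
    change F.map (seqι Y n.down) ≫ _ = _
    rw [← F.map_comp_assoc, Preadditive.comp_sub, seqι_seqShift, Category.comp_id, F.map_sub,
      Preadditive.sub_comp, F.map_comp, Category.assoc, heW', heW', hq, sub_self, comp_zero]
  obtain ⟨eZ, heZ⟩ := exists_map_cone_desc F hT eW h1
  have hW : localizingClosure S (seqSigma Y) :=
    (isLocalizing_localizingClosure S).sigma fun n => (A n.down).mem
  refine ⟨⟨Z, eZ, (isLocalizing_localizingClosure S).cone hT hW hW⟩, fun i => ⟨?_, ?_⟩⟩
  · have hinj : ∀ ψ : S i ⟶ Z, F.map ψ ≫ eZ = 0 → ψ = 0 := by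
      intro ψ hψ
      have hb : ψ ≫ b = 0 := by
        refine comp_shift_eq_zero (𝟙 (seqSigma Y) - seqShift q) (fun g hg => ?_) _ ?_
        · exact eq_zero_of_comp_one_sub_seqShift q ((hS i).shift (-1)) g hg
        · have := comp_distTriang_mor_zero₃₁ _ hT
          change b ≫ (𝟙 (seqSigma Y) - seqShift q)⟦(1 : ℤ)⟧' = 0 at this
          rw [Category.assoc, this, comp_zero]
      obtain ⟨l, rfl⟩ := exists_lift₃_of_distTriang hT ψ hb
      have ha : ∀ n, q n ≫ seqι Y (n + 1) ≫ a = seqι Y n ≫ a := by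
        intro n
        have h2 : (𝟙 (seqSigma Y) - seqShift q) ≫ a = 0 := comp_distTriang_mor_zero₁₂ _ hT
        have h3 := congrArg (fun k => seqι Y n ≫ k) h2
        simp only [Preadditive.sub_comp, Category.id_comp, Preadditive.comp_sub, comp_zero] at h3
        rw [seqι_seqShift_assoc, sub_eq_zero] at h3
        exact h3.symm
      obtain ⟨n, g, hg⟩ := exists_factor_seqι q (hS i) a ha l
      rw [hg, F.map_comp, F.map_comp, Category.assoc, Category.assoc, ← heZ, heW'] at hψ
      rw [hg, ← ha, reassoc_of% (hq' n i g hψ), zero_comp]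
    intro g g' h
    rw [← sub_eq_zero]
    refine hinj _ ?_
    rw [F.map_sub, Preadditive.sub_comp, sub_eq_zero]
    exact h
  · intro φ
    obtain ⟨g, hg⟩ := hA₀ i φ
    refine ⟨g ≫ seqι Y 0 ≫ a, ?_⟩
    change F.map (g ≫ seqι Y 0 ≫ a) ≫ eZ = φ
    rw [F.map_comp, F.map_comp, Category.assoc, Category.assoc, ← heZ, heW']
    exact hg

end Localizing

section Generation

variable {D : Type u₁} [Category.{v} D] [Preadditive D] [HasZeroObject D] [HasShift D ℤ]
  [∀ n : ℤ, (shiftFunctor D n).Additive] [Pretriangulated D] [HasCoproducts.{v} D]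

/-- A set of compact generators, closed under shifts up to isomorphism. -/
structure IsCompactGeneratingFamily {I : Type v} (S : I → D) : Prop where
  isCompactObj : ∀ i, IsCompactObj (S i)
  exists_shift : ∀ i (n : ℤ), ∃ j, Nonempty ((S i)⟦n⟧ ≅ S j)
  isZero : ∀ t : D, (∀ i (f : S i ⟶ t), f = 0) → IsZero t

lemma HasCompactGenerators.exists_family (hD : HasCompactGenerators D) :
    ∃ (I : Type v) (S : I → D), IsCompactGeneratingFamily S := by
  obtain ⟨ι, G, hG, hG'⟩ := hD
  refine ⟨ι × ℤ, fun p => (G p.1)⟦p.2⟧, fun p => (hG p.1).shift p.2, fun p n => ?_,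
    fun t ht => hG' t fun i f => ?_⟩
  · exact ⟨(p.1, p.2 + n), ⟨((shiftFunctorAdd D p.2 n).app (G p.1)).symm⟩⟩
  · rw [← cancel_epi ((shiftFunctorZero D ℤ).hom.app (G i)), comp_zero]
    exact ht (i, 0) _

lemma IsCompactGeneratingFamily.isIso {I : Type v} {S : I → D}
    (hS : IsCompactGeneratingFamily S) {X Y : D} (φ : X ⟶ Y)
    (h : ∀ i, Function.Bijective fun g : S i ⟶ X => g ≫ φ) : IsIso φ := by
  obtain ⟨Z, a, b, hT⟩ := distinguished_cocone_triangle φ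
  have hZ : IsZero Z := hS.isZero _ fun i f => by
    have h1 : f ≫ b = 0 := by
      refine comp_shift_eq_zero φ (fun g hg => ?_) _ ?_
      · obtain ⟨j, ⟨e⟩⟩ := hS.exists_shift i (-1)
        rw [← cancel_epi e.inv, comp_zero]
        refine (h j).1 ?_
        change (e.inv ≫ g) ≫ φ = 0 ≫ φ
        rw [Category.assoc, hg, comp_zero, zero_comp]
      · rw [Category.assoc, show b ≫ φ⟦(1 : ℤ)⟧' = 0 from comp_distTriang_mor_zero₃₁ _ hT,
          comp_zero]
    obtain ⟨g, hg⟩ := exists_lift₃_of_distTriang hT f h1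
    obtain ⟨k, hk⟩ := (h i).2 g
    change k ≫ φ = g at hk
    rw [hg, ← hk, Category.assoc, show φ ≫ a = 0 from comp_distTriang_mor_zero₁₂ _ hT, comp_zero]
  exact (Triangle.isZero₃_iff_isIso₁ _ hT).1 hZ

/-- The localizing subcategory generated by a set of compact generators is everything. -/
lemma IsCompactGeneratingFamily.of_isLocalizing {I : Type v} {S : I → D}
    (hS : IsCompactGeneratingFamily S) {P : D → Prop} (hP : IsLocalizing P)
    (h : ∀ i, P (S i)) (X : D) : P X := by
  obtain ⟨A, hA⟩ := exists_approx_bijective S (𝟭 D)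
    (preservesCoproducts_of_isLeftAdjoint _) X hS.isCompactObj
  have : IsIso A.hom := hS.isIso A.hom hA
  exact hP.of_iso (asIso A.hom) (A.mem P hP h)

lemma isLocalizing_forall_shift {Q : D → Prop} (hiso : ∀ {X Y : D}, (X ≅ Y) → Q X → Q Y)
    (hsigma : ∀ {J : Type v} {Y : J → D}, (∀ j, Q (Y j)) → Q (∐ Y))
    (hcone : ∀ {X Y Z : D} {f : X ⟶ Y} {g : Y ⟶ Z} {h : Z ⟶ X⟦(1 : ℤ)⟧},
      Triangle.mk f g h ∈ distTriang D → Q X → Q Y → Q (X⟦(1 : ℤ)⟧) → Q (Y⟦(1 : ℤ)⟧) → Q Z) :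
    IsLocalizing fun X => ∀ n : ℤ, Q (X⟦n⟧) where
  of_iso e h n := hiso ((shiftFunctor D n).mapIso e) (h n)
  shift h n m := hiso ((shiftFunctorAdd D n m).app _) (h (n + m))
  cone {X Y Z f g k} hT hX hY n := by
    have hT' := Triangle.shift_distinguished _ hT n
    exact hcone hT' (hX n) (hY n) (hiso ((shiftFunctorAdd D n 1).app X) (hX (n + 1)))
      (hiso ((shiftFunctorAdd D n 1).app Y) (hY (n + 1)))
  sigma {J Y} h n := hiso (asIso (sigmaComparison (shiftFunctor D n) Y)) (hsigma fun j => h j n)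

/-- Induction principle: a property satisfying the conclusion of the five lemma and stable under
coproducts can be checked on a set of compact generators. -/
lemma IsCompactGeneratingFamily.induction {I : Type v} {S : I → D}
    (hS : IsCompactGeneratingFamily S)
    {Q : D → Prop} (hiso : ∀ {X Y : D}, (X ≅ Y) → Q X → Q Y)
    (hsigma : ∀ {J : Type v} {Y : J → D}, (∀ j, Q (Y j)) → Q (∐ Y))
    (hcone : ∀ {X Y Z : D} {f : X ⟶ Y} {g : Y ⟶ Z} {h : Z ⟶ X⟦(1 : ℤ)⟧},
      Triangle.mk f g h ∈ distTriang D → Q X → Q Y → Q (X⟦(1 : ℤ)⟧) → Q (Y⟦(1 : ℤ)⟧) → Q Z)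
    (h : ∀ i, Q (S i)) (X : D) : Q X := by
  refine hiso ((shiftFunctorZero D ℤ).app X) (hS.of_isLocalizing
    (isLocalizing_forall_shift hiso hsigma hcone) (fun i n => ?_) X 0)
  obtain ⟨j, ⟨e⟩⟩ := hS.exists_shift i n
  exact hiso e.symm (h j)

end Generation

section FiveLemma

variable {A : Type u₁} [Category.{v} A] [Preadditive A] [HasZeroObject A] [HasShift A ℤ]
  [∀ n : ℤ, (shiftFunctor A n).Additive] [Pretriangulated A]
  {B : Type u₂} [Category.{v} B] [Preadditive B] [HasZeroObject B] [HasShift B ℤ]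
  [∀ n : ℤ, (shiftFunctor B n).Additive] [Pretriangulated B]

lemma exact_leftComp_of_distTriang {X Y Z : A} {f : X ⟶ Y} {g : Y ⟶ Z} {h : Z ⟶ X⟦(1 : ℤ)⟧}
    (hT : Triangle.mk f g h ∈ distTriang A) (W : A) :
    Function.Exact (Preadditive.leftComp W g) (Preadditive.leftComp W f) := by
  intro k
  constructor
  · intro hk
    obtain ⟨l, hl⟩ := exists_desc_of_distTriang hT k hk
    exact ⟨l, hl.symm⟩
  · rintro ⟨l, rfl⟩
    change f ≫ g ≫ l = 0
    rw [← Category.assoc, show f ≫ g = 0 from comp_distTriang_mor_zero₁₂ _ hT, zero_comp]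

lemma exact_rightComp_of_distTriang {X Y Z : A} {f : X ⟶ Y} {g : Y ⟶ Z} {h : Z ⟶ X⟦(1 : ℤ)⟧}
    (hT : Triangle.mk f g h ∈ distTriang A) (W : A) :
    Function.Exact (Preadditive.rightComp W f) (Preadditive.rightComp W g) := by
  intro k
  constructor
  · intro hk
    obtain ⟨l, hl⟩ := exists_lift_of_distTriang hT k hk
    exact ⟨l, hl.symm⟩
  · rintro ⟨l, rfl⟩
    change (l ≫ f) ≫ g = 0
    rw [Category.assoc, show f ≫ g = 0 from comp_distTriang_mor_zero₁₂ _ hT, comp_zero]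

/-- The five lemma for contravariant hom functors out of two distinguished triangles. -/
lemma bijective_of_distTriang_contravariant
    {X Y Z : A} {f : X ⟶ Y} {g : Y ⟶ Z} {h : Z ⟶ X⟦(1 : ℤ)⟧}
    (hT : Triangle.mk f g h ∈ distTriang A)
    {X' Y' Z' : B} {f' : X' ⟶ Y'} {g' : Y' ⟶ Z'} {h' : Z' ⟶ X'⟦(1 : ℤ)⟧}
    (hT' : Triangle.mk f' g' h' ∈ distTriang B) {a : A} {b : B}
    (φX : (X ⟶ a) →+ (X' ⟶ b)) (φY : (Y ⟶ a) →+ (Y' ⟶ b)) (φZ : (Z ⟶ a) →+ (Z' ⟶ b))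
    (φX₁ : (X⟦(1 : ℤ)⟧ ⟶ a) →+ (X'⟦(1 : ℤ)⟧ ⟶ b))
    (φY₁ : (Y⟦(1 : ℤ)⟧ ⟶ a) →+ (Y'⟦(1 : ℤ)⟧ ⟶ b))
    (hf : ∀ k, φX (f ≫ k) = f' ≫ φY k) (hg : ∀ k, φY (g ≫ k) = g' ≫ φZ k)
    (hh : ∀ k, φZ (h ≫ k) = h' ≫ φX₁ k)
    (hf₁ : ∀ k, φX₁ (f⟦(1 : ℤ)⟧' ≫ k) = f'⟦(1 : ℤ)⟧' ≫ φY₁ k)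
    (hX : Function.Bijective φX) (hY : Function.Bijective φY)
    (hX₁ : Function.Bijective φX₁) (hY₁ : Function.Bijective φY₁) : Function.Bijective φZ := by
  have hr := rot_of_distTriang _ hT
  have hr' := rot_of_distTriang _ hT'
  have hrr := rot_of_distTriang _ hr
  have hrr' := rot_of_distTriang _ hr'
  refine AddMonoidHom.bijective_of_surjective_of_bijective_of_bijective_of_injective
    (Preadditive.leftComp a (-f⟦(1 : ℤ)⟧')) (Preadditive.leftComp a h) (Preadditive.leftComp a g)
    (Preadditive.leftComp a f)
    (Preadditive.leftComp b (-f'⟦(1 : ℤ)⟧')) (Preadditive.leftComp b h')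
    (Preadditive.leftComp b g') (Preadditive.leftComp b f') φY₁ φX₁ φZ φY φX ?_ ?_ ?_ ?_
    (exact_leftComp_of_distTriang hrr a) (exact_leftComp_of_distTriang hr a)
    (exact_leftComp_of_distTriang hT a)
    (exact_leftComp_of_distTriang hrr' b) (exact_leftComp_of_distTriang hr' b)
    (exact_leftComp_of_distTriang hT' b) hY₁.2 hX₁ hY hX.1
  · ext k
    change (-f'⟦(1 : ℤ)⟧') ≫ φY₁ k = φX₁ ((-f⟦(1 : ℤ)⟧') ≫ k)
    rw [Preadditive.neg_comp, Preadditive.neg_comp, map_neg, hf₁]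
  · ext k
    exact (hh k).symm
  · ext k
    exact (hg k).symm
  · ext k
    exact (hf k).symm

/-- The five lemma for covariant hom functors into two distinguished triangles. -/
lemma bijective_of_distTriang_covariant
    {X Y Z : A} {f : X ⟶ Y} {g : Y ⟶ Z} {h : Z ⟶ X⟦(1 : ℤ)⟧}
    (hT : Triangle.mk f g h ∈ distTriang A)
    {X' Y' Z' : B} {f' : X' ⟶ Y'} {g' : Y' ⟶ Z'} {h' : Z' ⟶ X'⟦(1 : ℤ)⟧}
    (hT' : Triangle.mk f' g' h' ∈ distTriang B) {a : A} {b : B}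
    (φX : (a ⟶ X) →+ (b ⟶ X')) (φY : (a ⟶ Y) →+ (b ⟶ Y')) (φZ : (a ⟶ Z) →+ (b ⟶ Z'))
    (φX₁ : (a ⟶ X⟦(1 : ℤ)⟧) →+ (b ⟶ X'⟦(1 : ℤ)⟧))
    (φY₁ : (a ⟶ Y⟦(1 : ℤ)⟧) →+ (b ⟶ Y'⟦(1 : ℤ)⟧))
    (hf : ∀ k, φY (k ≫ f) = φX k ≫ f') (hg : ∀ k, φZ (k ≫ g) = φY k ≫ g')
    (hh : ∀ k, φX₁ (k ≫ h) = φZ k ≫ h')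
    (hf₁ : ∀ k, φY₁ (k ≫ f⟦(1 : ℤ)⟧') = φX₁ k ≫ f'⟦(1 : ℤ)⟧')
    (hX : Function.Bijective φX) (hY : Function.Bijective φY)
    (hX₁ : Function.Bijective φX₁) (hY₁ : Function.Bijective φY₁) : Function.Bijective φZ := by
  have hr := rot_of_distTriang _ hT
  have hr' := rot_of_distTriang _ hT'
  have hrr := rot_of_distTriang _ hr
  have hrr' := rot_of_distTriang _ hr'
  refine AddMonoidHom.bijective_of_surjective_of_bijective_of_bijective_of_injective
    (Preadditive.rightComp a f) (Preadditive.rightComp a g) (Preadditive.rightComp a h)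
    (Preadditive.rightComp a (-f⟦(1 : ℤ)⟧'))
    (Preadditive.rightComp b f') (Preadditive.rightComp b g') (Preadditive.rightComp b h')
    (Preadditive.rightComp b (-f'⟦(1 : ℤ)⟧')) φX φY φZ φX₁ φY₁ ?_ ?_ ?_ ?_
    (exact_rightComp_of_distTriang hT a) (exact_rightComp_of_distTriang hr a)
    (exact_rightComp_of_distTriang hrr a)
    (exact_rightComp_of_distTriang hT' b) (exact_rightComp_of_distTriang hr' b)
    (exact_rightComp_of_distTriang hrr' b) hX.2 hY hX₁ hY₁.1
  · ext k
    exact (hf k).symm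
  · ext k
    exact (hg k).symm
  · ext k
    exact (hh k).symm
  · ext k
    change φX₁ k ≫ (-f'⟦(1 : ℤ)⟧') = φY₁ (k ≫ (-f⟦(1 : ℤ)⟧'))
    rw [Preadditive.comp_neg, Preadditive.comp_neg, map_neg, hf₁]

end FiveLemma

section Brown

variable {D : Type u₁} [Category.{v} D] [Preadditive D] [HasZeroObject D] [HasShift D ℤ]
  [∀ n : ℤ, (shiftFunctor D n).Additive] [Pretriangulated D] [HasCoproducts.{v} D]
  {C : Type u₂} [Category.{v} C] [Preadditive C] [HasZeroObject C] [HasShift C ℤ]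
  [∀ n : ℤ, (shiftFunctor C n).Additive] [Pretriangulated C]
  (F : D ⥤ C) [F.CommShift ℤ] [F.IsTriangulated]

/-- Postcomposition of the action of `F` on morphisms with a fixed morphism. -/
def mapComp {Y : D} {y : C} (e : F.obj Y ⟶ y) (X : D) : (X ⟶ Y) →+ (F.obj X ⟶ y) :=
  (Preadditive.rightComp (F.obj X) e).comp F.mapAddHom

lemma mapComp_apply {Y : D} {y : C} (e : F.obj Y ⟶ y) {X : D} (g : X ⟶ Y) :
    mapComp F e X g = F.map g ≫ e := rfl

/-- Precomposition of the action of `F` on morphisms with a fixed morphism. -/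
def compMap {L : D} {c : C} (w : c ⟶ F.obj L) (X : D) : (L ⟶ X) →+ (c ⟶ F.obj X) :=
  (Preadditive.leftComp (F.obj X) w).comp F.mapAddHom

lemma compMap_apply {L : D} {c : C} (w : c ⟶ F.obj L) {X : D} (g : L ⟶ X) :
    compMap F w X g = w ≫ F.map g := rfl

lemma mapComp_bijective {I : Type v} {S : I → D} (hS : IsCompactGeneratingFamily S)
    (hF : PreservesCoproducts F) {Y : D} {y : C} (e : F.obj Y ⟶ y)
    (h : ∀ i, Function.Bijective (mapComp F e (S i))) (X : D) :
    Function.Bijective (mapComp F e X) := by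
  refine hS.induction (Q := fun X => Function.Bijective (mapComp F e X)) ?_ ?_ ?_ h X
  · intro X X' i h
    constructor
    · intro g g' hg
      rw [← cancel_epi i.hom]
      apply h.1
      simp only [mapComp_apply, F.map_comp, Category.assoc] at hg ⊢
      rw [hg]
    · intro φ
      obtain ⟨g, hg⟩ := h.2 (F.map i.hom ≫ φ)
      refine ⟨i.inv ≫ g, ?_⟩
      rw [mapComp_apply] at hg ⊢
      rw [F.map_comp, Category.assoc, hg, ← F.map_comp_assoc, i.inv_hom_id, F.map_id,
        Category.id_comp]
  · intro J Z h
    constructor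
    · intro g g' hg
      refine Sigma.hom_ext _ _ fun j => (h j).1 ?_
      simp only [mapComp_apply, F.map_comp, Category.assoc] at hg ⊢
      rw [hg]
    · intro φ
      choose g hg using fun j => (h j).2 (F.map (Sigma.ι Z j) ≫ φ)
      refine ⟨Sigma.desc g, map_sigma_hom_ext hF fun j => ?_⟩
      rw [mapComp_apply, ← F.map_comp_assoc, Sigma.ι_desc]
      exact hg j
  · intro X Y' Z f g k hT hX hY hX₁ hY₁
    have hpre : ∀ W : D, Function.Bijective
        (Preadditive.leftComp y ((F.commShiftIso (1 : ℤ)).inv.app W)) := fun W =>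
      ⟨fun a b hab => (cancel_epi ((F.commShiftIso (1 : ℤ)).inv.app W)).1 hab, fun a =>
        ⟨(F.commShiftIso (1 : ℤ)).hom.app W ≫ a, by
          change (F.commShiftIso (1 : ℤ)).inv.app W ≫ _ = _
          simp⟩⟩
    refine bijective_of_distTriang_contravariant hT (F.map_distinguished _ hT)
      (mapComp F e X) (mapComp F e Y') (mapComp F e Z)
      ((Preadditive.leftComp y ((F.commShiftIso (1 : ℤ)).inv.app X)).comp (mapComp F e _))
      ((Preadditive.leftComp y ((F.commShiftIso (1 : ℤ)).inv.app Y')).comp (mapComp F e _))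
      ?_ ?_ ?_ ?_ hX hY ((hpre X).comp hX₁) ((hpre Y').comp hY₁)
    · intro l
      exact (congrArg (· ≫ e) (F.map_comp f l)).trans (Category.assoc _ _ _)
    · intro l
      exact (congrArg (· ≫ e) (F.map_comp g l)).trans (Category.assoc _ _ _)
    · intro l
      change F.map (k ≫ l) ≫ e = (F.map k ≫ (F.commShiftIso (1 : ℤ)).hom.app X) ≫
        (F.commShiftIso (1 : ℤ)).inv.app X ≫ F.map l ≫ e
      simp
    · intro l
      change (F.commShiftIso (1 : ℤ)).inv.app X ≫ F.map (f⟦(1 : ℤ)⟧' ≫ l) ≫ e =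
        (F.map f)⟦(1 : ℤ)⟧' ≫ (F.commShiftIso (1 : ℤ)).inv.app Y' ≫ F.map l ≫ e
      have := (F.commShiftIso (1 : ℤ)).inv.naturality f
      simp only [Functor.comp_map] at this
      rw [F.map_comp, Category.assoc, reassoc_of% this]

/-- Brown representability: a triangulated functor preserving coproducts out of a compactly
generated category has a right adjoint. -/
lemma isLeftAdjoint_of_preservesCoproducts (hD : HasCompactGenerators D)
    (hF : PreservesCoproducts F) : F.IsLeftAdjoint := by
  obtain ⟨I, S, hS⟩ := hD.exists_family
  refine Functor.isLeftAdjoint_of_rightAdjointObjIsDefined_eq_top ?_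
  ext y
  simp only [Pi.top_apply, Prop.top_eq_true, iff_true]
  obtain ⟨A, hA⟩ := exists_approx_bijective S F hF y hS.isCompactObj
  have := mapComp_bijective F hS hF A.hom hA
  have r : (F.op ⋙ yoneda.obj y).RepresentableBy A.obj :=
    { homEquiv := fun {X} => Equiv.ofBijective _ (this X)
      homEquiv_comp := fun f g => by
        change F.map (f ≫ g) ≫ A.hom = F.map f ≫ F.map g ≫ A.hom
        simp }
  exact r.isRepresentable

end Brown

section LeftAdjoint

variable {D : Type u₁} [Category.{v} D] [Preadditive D] [HasZeroObject D] [HasShift D ℤ]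
  [∀ n : ℤ, (shiftFunctor D n).Additive] [Pretriangulated D] [HasCoproducts.{v} D]
  {C : Type u₂} [Category.{v} C] [Preadditive C] [HasZeroObject C] [HasShift C ℤ]
  [∀ n : ℤ, (shiftFunctor C n).Additive] [Pretriangulated C] [HasCoproducts.{v} C]
  (F : D ⥤ C) [F.CommShift ℤ] [F.IsTriangulated]

lemma compMap_bijective {I : Type v} {S : I → D} (hS : IsCompactGeneratingFamily S)
    (hF : PreservesCoproducts F) {L : D} {c : C} (hL : IsCompactObj L) (hc : IsCompactObj c)
    (w : c ⟶ F.obj L) (h : ∀ i, Function.Bijective (compMap F w (S i))) (X : D) :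
    Function.Bijective (compMap F w X) := by
  classical
  refine hS.induction (Q := fun X => Function.Bijective (compMap F w X)) ?_ ?_ ?_ h X
  · intro X X' i h
    constructor
    · intro g g' hg
      rw [← cancel_mono i.inv]
      apply h.1
      simp only [compMap_apply, F.map_comp] at hg ⊢
      rw [reassoc_of% hg]
    · intro φ
      obtain ⟨g, hg⟩ := h.2 (φ ≫ F.map i.inv)
      refine ⟨g ≫ i.hom, ?_⟩
      rw [compMap_apply] at hg ⊢
      rw [F.map_comp, reassoc_of% hg, ← F.map_comp, i.inv_hom_id, F.map_id, Category.comp_id]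
  · intro J Z h
    obtain ⟨_⟩ := hF J
    constructor
    · refine (injective_iff_map_eq_zero _).2 fun g hg => ?_
      rw [compMap_apply] at hg
      obtain ⟨s, g', hs⟩ := hL.exists_finset g
      rw [hs]
      refine Finset.sum_eq_zero fun j hj => ?_
      have h4 := (comp_sigmaπ_of_eq_sum hs j).trans (if_pos hj)
      have : g' j = 0 := (h j).1 <| by
        rw [map_zero, compMap_apply, ← h4, F.map_comp, reassoc_of% hg, zero_comp]
      rw [this, zero_comp]
    · intro φ
      obtain ⟨s, k, hs⟩ := hc.exists_finset (φ ≫ inv (sigmaComparison F Z))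
      choose g hg using fun j => (h j).2 (k j)
      refine ⟨∑ j ∈ s, g j ≫ Sigma.ι Z j, ?_⟩
      rw [IsIso.comp_inv_eq, Preadditive.sum_comp] at hs
      rw [map_sum, hs]
      refine Finset.sum_congr rfl fun j _ => ?_
      rw [Category.assoc, ι_comp_sigmaComparison, ← hg, compMap_apply, compMap_apply, F.map_comp,
        Category.assoc]
  · intro X Y' Z f g k hT hX hY hX₁ hY₁
    have hpost : ∀ W : D, Function.Bijective
        (Preadditive.rightComp c ((F.commShiftIso (1 : ℤ)).hom.app W)) := fun W =>
      ⟨fun a b hab => (cancel_mono ((F.commShiftIso (1 : ℤ)).hom.app W)).1 hab, fun a =>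
        ⟨a ≫ (F.commShiftIso (1 : ℤ)).inv.app W, by
          change (_ ≫ _) ≫ (F.commShiftIso (1 : ℤ)).hom.app W = _
          simp⟩⟩
    refine bijective_of_distTriang_covariant hT (F.map_distinguished _ hT)
      (compMap F w X) (compMap F w Y') (compMap F w Z)
      ((Preadditive.rightComp c ((F.commShiftIso (1 : ℤ)).hom.app X)).comp (compMap F w _))
      ((Preadditive.rightComp c ((F.commShiftIso (1 : ℤ)).hom.app Y')).comp (compMap F w _))
      ?_ ?_ ?_ ?_ hX hY ((hpost X).comp hX₁) ((hpost Y').comp hY₁)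
    · intro l
      exact (congrArg (w ≫ ·) (F.map_comp l f)).trans (Category.assoc _ _ _).symm
    · intro l
      exact (congrArg (w ≫ ·) (F.map_comp l g)).trans (Category.assoc _ _ _).symm
    · intro l
      change (w ≫ F.map (l ≫ k)) ≫ (F.commShiftIso (1 : ℤ)).hom.app X =
        (w ≫ F.map l) ≫ F.map k ≫ (F.commShiftIso (1 : ℤ)).hom.app X
      simp
    · intro l
      change (w ≫ F.map (l ≫ f⟦(1 : ℤ)⟧')) ≫ (F.commShiftIso (1 : ℤ)).hom.app Y' =
        ((w ≫ F.map l) ≫ (F.commShiftIso (1 : ℤ)).hom.app X) ≫ (F.map f)⟦(1 : ℤ)⟧'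
      simp

lemma bijective_shift_comp {A : Type u₁} [Category.{v} A] [HasShift A ℤ] (n : ℤ) {X Y Z : A}
    (e : Y⟦n⟧ ⟶ Z) [IsIso e] : Function.Bijective fun g : X ⟶ Y => g⟦n⟧' ≫ e :=
  ⟨fun _ _ h => (shiftFunctor A n).map_injective ((cancel_mono e).1 h), fun k => by
    obtain ⟨g, hg⟩ := (shiftFunctor A n).map_surjective (k ≫ inv e)
    exact ⟨g, by simp [hg]⟩⟩

lemma compMap_shift_bijective {L : D} {c : C} (w : c ⟶ F.obj L)
    (h : ∀ X, Function.Bijective (compMap F w X)) (n : ℤ) (X : D) :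
    Function.Bijective (compMap F (w⟦n⟧' ≫ (F.commShiftIso n).inv.app L) X) := by
  let e : X⟦-n⟧⟦n⟧ ≅ X := (shiftFunctorCompIsoId D (-n) n (by simp)).app X
  have h1 := bijective_shift_comp n (X := L) e.hom
  rw [← Function.Bijective.of_comp_iff _ h1]
  have h2 := bijective_shift_comp n (X := c) ((F.commShiftIso n).inv.app _ ≫ F.map e.hom)
  convert h2.comp (h (X⟦-n⟧)) using 1
  ext g
  have := (F.commShiftIso n).inv.naturality g
  simp only [Functor.comp_map] at this
  simp [compMap_apply, reassoc_of% this]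

/-- The objects at which a left adjoint of `F` is defined form a localizing subcategory. -/
lemma isLocalizing_exists_compMap_bijective :
    IsLocalizing fun c : C => ∃ (L : D) (w : c ⟶ F.obj L), ∀ X,
      Function.Bijective (compMap F w X) where
  of_iso := by
    rintro c c' i ⟨L, w, h⟩
    refine ⟨L, i.inv ≫ w, fun X => ⟨fun g g' hg => (h X).1 ?_, fun φ => ?_⟩⟩
    · rw [compMap_apply, compMap_apply, Category.assoc, Category.assoc, cancel_epi] at hg
      exact hg
    · obtain ⟨g, hg⟩ := (h X).2 (i.hom ≫ φ)
      refine ⟨g, ?_⟩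
      rw [compMap_apply] at hg ⊢
      rw [Category.assoc, hg, i.inv_hom_id_assoc]
  shift := by
    rintro c ⟨L, w, h⟩ n
    exact ⟨_, _, compMap_shift_bijective F w h n⟩
  cone := by
    rintro c₁ c₂ c₃ f g k hT ⟨L₁, w₁, h₁⟩ ⟨L₂, w₂, h₂⟩
    obtain ⟨l, hl⟩ := (h₁ L₂).2 (f ≫ w₂)
    rw [compMap_apply] at hl
    obtain ⟨L₃, a, b, hT'⟩ := distinguished_cocone_triangle l
    have hFT := F.map_distinguished _ hT'
    have hcompl : ∃ w₃ : c₃ ⟶ F.obj L₃, g ≫ w₃ = w₂ ≫ F.map a ∧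
        k ≫ w₁⟦(1 : ℤ)⟧' = w₃ ≫ F.map b ≫ (F.commShiftIso (1 : ℤ)).hom.app L₁ :=
      complete_distinguished_triangle_morphism _ _ hT hFT w₁ w₂ hl.symm
    obtain ⟨w₃, hw, hw'⟩ := hcompl
    have hl' : f⟦(1 : ℤ)⟧' ≫ w₂⟦(1 : ℤ)⟧' = w₁⟦(1 : ℤ)⟧' ≫ (F.map l)⟦(1 : ℤ)⟧' := by
      rw [← Functor.map_comp, ← hl, Functor.map_comp]
    refine ⟨L₃, w₃, fun X => ?_⟩
    refine bijective_of_distTriang_contravariant hT' hT (compMap F w₁ X) (compMap F w₂ X)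
      (compMap F w₃ X)
      (compMap F (w₁⟦(1 : ℤ)⟧' ≫ (F.commShiftIso (1 : ℤ)).inv.app L₁) X)
      (compMap F (w₂⟦(1 : ℤ)⟧' ≫ (F.commShiftIso (1 : ℤ)).inv.app L₂) X) ?_ ?_ ?_ ?_
      (h₁ X) (h₂ X) (compMap_shift_bijective F w₁ h₁ 1 X) (compMap_shift_bijective F w₂ h₂ 1 X)
    · intro m
      rw [compMap_apply, compMap_apply, F.map_comp, reassoc_of% hl]
    · intro m
      rw [compMap_apply, compMap_apply, F.map_comp, reassoc_of% hw]
    · intro m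
      rw [compMap_apply, compMap_apply, F.map_comp, Category.assoc, reassoc_of% hw']
      simp
    · intro m
      have := (F.commShiftIso (1 : ℤ)).inv.naturality l
      simp only [Functor.comp_map] at this
      rw [compMap_apply, compMap_apply, F.map_comp, Category.assoc, Category.assoc,
        reassoc_of% hl', reassoc_of% this]
  sigma := by
    intro J c h
    choose L w h using h
    refine ⟨∐ L, Sigma.desc fun j => w j ≫ F.map (Sigma.ι L j), fun X => ⟨?_, ?_⟩⟩
    · intro g g' hg
      refine Sigma.hom_ext _ _ fun j => (h j X).1 ?_
      have := congrArg (fun k => Sigma.ι c j ≫ k) hg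
      simpa [compMap_apply] using this
    · intro φ
      choose g hg using fun j => (h j X).2 (Sigma.ι c j ≫ φ)
      refine ⟨Sigma.desc g, Sigma.hom_ext _ _ fun j => ?_⟩
      rw [← hg, compMap_apply, compMap_apply, Sigma.ι_desc_assoc, Category.assoc, ← F.map_comp,
        Sigma.ι_desc]

/-- A criterion for the existence of a left adjoint, to be checked on compact objects. -/
lemma isRightAdjoint_of_compact (hD : HasCompactGenerators D) (hC : HasCompactGenerators C)
    (hF : PreservesCoproducts F)
    (h : ∀ c : C, IsCompactObj c → ∃ (L : D) (w : c ⟶ F.obj L), IsCompactObj L ∧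
      ∀ X, IsCompactObj X → Function.Bijective fun g : L ⟶ X => w ≫ F.map g) :
    F.IsRightAdjoint := by
  obtain ⟨I, S, hS⟩ := hD.exists_family
  obtain ⟨I', S', hS'⟩ := hC.exists_family
  refine Functor.isRightAdjoint_of_leftAdjointObjIsDefined_eq_top ?_
  ext c
  simp only [Pi.top_apply, Prop.top_eq_true, iff_true]
  obtain ⟨L, w, hw⟩ := hS'.of_isLocalizing (isLocalizing_exists_compMap_bijective F)
    (fun i => by
      obtain ⟨L, w, hL, hw⟩ := h _ (hS'.isCompactObj i)
      exact ⟨L, w, compMap_bijective F hS hF hL (hS'.isCompactObj i) w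
        fun i => hw _ (hS.isCompactObj i)⟩) c
  have r : (F ⋙ coyoneda.obj (op c)).CorepresentableBy L :=
    { homEquiv := fun {X} => Equiv.ofBijective _ (hw X)
      homEquiv_comp := fun g f => by
        change w ≫ F.map (f ≫ g) = (w ≫ F.map f) ≫ F.map g
        simp }
  exact r.isCorepresentable

end LeftAdjoint

section Rigid

variable {C : Type u} [Category.{v} C] [MonoidalCategory C]

omit [MonoidalCategory C] in
lemma isIso_of_bijective_comp {X Y : C} (φ : X ⟶ Y)
    (h : ∀ c : C, Function.Bijective fun g : c ⟶ X => g ≫ φ) : IsIso φ := by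
  obtain ⟨s, hs⟩ := (h Y).2 (𝟙 Y)
  dsimp only at hs
  exact ⟨s, (h X).1 (by simp [hs]), hs⟩

lemma tensorLeftHomEquiv_symm_apply {X Y Y' Z : C} [ExactPairing Y Y'] (f : X ⟶ Y ⊗ Z) :
    (tensorLeftHomEquiv X Y Y' Z).symm f =
      Y' ◁ f ≫ (α_ Y' Y Z).inv ≫ ε_ Y Y' ▷ Z ≫ (λ_ Z).hom := rfl

lemma tensorRightHomEquiv_symm_apply {X Y Y' Z : C} [ExactPairing Y Y'] (f : X ⟶ Z ⊗ Y') :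
    (tensorRightHomEquiv X Y Y' Z).symm f =
      f ▷ Y ≫ (α_ Z Y' Y).hom ≫ Z ◁ ε_ Y Y' ≫ (ρ_ Z).hom := rfl

variable [MonoidalClosed C]

lemma uncurry_rigidComparison (x y : C) :
    uncurry (rigidComparison x y) =
      (α_ x ((ihom x).obj (𝟙_ C)) y).inv ≫ (((ihom.ev x).app (𝟙_ C)) ▷ y) ≫ (λ_ y).hom :=
  uncurry_curry _

/-- The dual of a rigid object. -/
lemma IsRigid.exists_exactPairing {x : C} (hx : IsRigid x) :
    ∃ x' : C, Nonempty (ExactPairing x' x) := by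
  have := hx x
  have := hx (𝟙_ C)
  let X := (ihom x).obj (𝟙_ C)
  let η : 𝟙_ C ⟶ X ⊗ x := curry (ρ_ x).hom ≫ inv (rigidComparison x x)
  let ev : x ⊗ X ⟶ 𝟙_ C := (ihom.ev x).app (𝟙_ C)
  have hη : x ◁ η ≫ (α_ x X x).inv ≫ ev ▷ x ≫ (λ_ x).hom = (ρ_ x).hom := by
    rw [← uncurry_rigidComparison, ← uncurry_natural_left]
    simp [η, uncurry_curry]
  have hη' : x ◁ η ⊗≫ ev ▷ x = ⊗𝟙.hom := by
    have : x ◁ η ≫ (α_ x X x).inv ≫ ev ▷ x = (ρ_ x).hom ≫ (λ_ x).inv := by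
      rw [← hη]; simp
    convert! this <;> simp [monoidalComp]
  refine ⟨X, ⟨⟨η, ev, ?_, ?_⟩⟩⟩
  · rw [← cancel_mono (λ_ x).hom]
    simpa using hη
  · rw [← cancel_mono (rigidComparison x (𝟙_ C))]
    apply uncurry_injective
    rw [uncurry_natural_left, uncurry_natural_left, uncurry_rigidComparison]
    change x ◁ (η ▷ X ≫ (α_ X x X).hom ≫ X ◁ ev) ≫ (α_ x X (𝟙_ C)).inv ≫ ev ▷ 𝟙_ C ≫
      (λ_ (𝟙_ C)).hom = x ◁ ((λ_ X).hom ≫ (ρ_ X).inv) ≫ (α_ x X (𝟙_ C)).inv ≫ ev ▷ 𝟙_ C ≫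
      (λ_ (𝟙_ C)).hom
    calc _ = 𝟙 _ ⊗≫ x ◁ η ▷ X ⊗≫ ((x ⊗ X) ◁ ev ≫ ev ▷ 𝟙_ C) ⊗≫ 𝟙 _ := by monoidal
      _ = 𝟙 _ ⊗≫ (x ◁ η ⊗≫ ev ▷ x) ▷ X ⊗≫ ev ⊗≫ 𝟙 _ := by
        rw [whisker_exchange]; monoidal
      _ = _ := by rw [hη']; monoidal

lemma isRigid_of_exactPairing (x' x : C) [ExactPairing x' x] : IsRigid x := by
  let θ (y : C) : x' ⊗ y ⟶ (ihom x).obj y :=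
    curry ((α_ x x' y).inv ≫ ε_ x' x ▷ y ≫ (λ_ y).hom)
  have hθ (y : C) : IsIso (θ y) := by
    apply isIso_of_bijective_comp
    intro c
    have : (fun g : c ⟶ x' ⊗ y => g ≫ θ y) =
        ((tensorLeftHomEquiv c x' x y).symm.trans ((ihom.adjunction x).homEquiv c y)) := by
      ext g
      apply uncurry_injective
      rw [uncurry_natural_left]
      simp only [θ, uncurry_curry]
      exact ((uncurry_curry _).symm : _ = uncurry (curry ((tensorLeftHomEquiv c x' x y).symm g)))
    rw [this]
    exact Equiv.bijective _
  let i : x' ⟶ (ihom x).obj (𝟙_ C) := (ρ_ x').inv ≫ θ (𝟙_ C)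
  have hi : uncurry i = ε_ x' x := by
    simp only [i, uncurry_natural_left, θ, uncurry_curry]
    monoidal
  intro y
  have h : i ▷ y ≫ rigidComparison x y = θ y := by
    apply uncurry_injective
    rw [uncurry_natural_left, uncurry_rigidComparison]
    simp only [θ, uncurry_curry]
    rw [← hi, uncurry_eq]
    simp
  have : IsIso (i ▷ y ≫ rigidComparison x y) := by rw [h]; infer_instance
  exact IsIso.of_isIso_comp_left (i ▷ y) _

end Rigid

section Mate

variable {C : Type u} [Category.{v} C] [MonoidalCategory C]

/-- `m` is the transpose of `f` with respect to given exact pairings. -/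
def IsMate {X X' Y Y' : C} [ExactPairing X X'] [ExactPairing Y Y'] (f : X ⟶ Y) (m : Y' ⟶ X') :
    Prop :=
  Y' ◁ f ≫ ε_ Y Y' = m ▷ X ≫ ε_ X X'

section

variable {X X' Y Y' Z Z' : C} [ExactPairing X X'] [ExactPairing Y Y'] [ExactPairing Z Z']

lemma IsMate.comp {f : X ⟶ Y} {m : Y' ⟶ X'} {g : Y ⟶ Z} {n : Z' ⟶ Y'} (hf : IsMate f m)
    (hg : IsMate g n) : IsMate (f ≫ g) (n ≫ m) := by
  unfold IsMate at *
  rw [MonoidalCategory.whiskerLeft_comp, Category.assoc, hg, ← Category.assoc, whisker_exchange,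
    Category.assoc, hf, comp_whiskerRight, Category.assoc]

lemma bijective_whiskerLeft_comp_evaluation (X Y Y' : C) [ExactPairing Y Y'] :
    Function.Bijective fun f : X ⟶ Y => Y' ◁ f ≫ ε_ Y Y' := by
  have : (fun f : X ⟶ Y => Y' ◁ f ≫ ε_ Y Y') = fun f =>
      (tensorLeftHomEquiv X Y Y' (𝟙_ C)).symm (f ≫ (ρ_ Y).inv) := by
    ext f
    rw [tensorLeftHomEquiv_symm_apply]
    monoidal
  rw [this]
  refine (Equiv.bijective _).comp ⟨fun a b h => ?_, fun b => ⟨b ≫ (ρ_ Y).hom, by simp⟩⟩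
  simpa using h

lemma bijective_whiskerRight_comp_evaluation (X X' Y' : C) [ExactPairing X X'] :
    Function.Bijective fun m : Y' ⟶ X' => m ▷ X ≫ ε_ X X' := by
  have : (fun m : Y' ⟶ X' => m ▷ X ≫ ε_ X X') = fun m =>
      (tensorRightHomEquiv Y' X X' (𝟙_ C)).symm (m ≫ (λ_ X').inv) := by
    ext f
    rw [tensorRightHomEquiv_symm_apply]
    monoidal
  rw [this]
  refine (Equiv.bijective _).comp ⟨fun a b h => ?_, fun b => ⟨b ≫ (λ_ X').hom, by simp⟩⟩
  simpa using h

lemma IsMate.exists_unique_right (f : X ⟶ Y) : ∃! m : Y' ⟶ X', IsMate f m := by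
  obtain ⟨m, hm⟩ := (bijective_whiskerRight_comp_evaluation X X' Y').2 (Y' ◁ f ≫ ε_ Y Y')
  exact ⟨m, hm.symm, fun n hn =>
    (bijective_whiskerRight_comp_evaluation X X' Y').1 (hn.symm.trans hm.symm)⟩

lemma IsMate.exists_unique_left (m : Y' ⟶ X') : ∃! f : X ⟶ Y, IsMate f m := by
  obtain ⟨f, hf⟩ := (bijective_whiskerLeft_comp_evaluation X Y Y').2 (m ▷ X ≫ ε_ X X')
  exact ⟨f, hf, fun g hg =>
    (bijective_whiskerLeft_comp_evaluation X Y Y').1 (Eq.trans hg hf.symm)⟩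

variable (X X' Y Y') in
/-- Transposition is a bijection between morphisms of objects and of their duals. -/
def mateEquiv : (X ⟶ Y) ≃ (Y' ⟶ X') where
  toFun f := (IsMate.exists_unique_right f).choose
  invFun m := (IsMate.exists_unique_left m).choose
  left_inv f := ((IsMate.exists_unique_left _).choose_spec.2 f
    (IsMate.exists_unique_right f).choose_spec.1).symm
  right_inv m := ((IsMate.exists_unique_right _).choose_spec.2 m
    (IsMate.exists_unique_left m).choose_spec.1).symm

lemma isMate_mateEquiv (f : X ⟶ Y) : IsMate f (mateEquiv X X' Y Y' f) :=
  (IsMate.exists_unique_right f).choose_spec.1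

lemma IsMate.mateEquiv_eq {f : X ⟶ Y} {m : Y' ⟶ X'} (h : IsMate f m) :
    mateEquiv X X' Y Y' f = m :=
  ((IsMate.exists_unique_right f).choose_spec.2 m h).symm

lemma mateEquiv_eq_iff {f : X ⟶ Y} {m : Y' ⟶ X'} : mateEquiv X X' Y Y' f = m ↔ IsMate f m :=
  ⟨fun h => h ▸ isMate_mateEquiv f, IsMate.mateEquiv_eq⟩

lemma mateEquiv_comp (f : X ⟶ Y) (g : Y ⟶ Z) :
    mateEquiv X X' Z Z' (f ≫ g) = mateEquiv Y Y' Z Z' g ≫ mateEquiv X X' Y Y' f :=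
  ((isMate_mateEquiv f).comp (isMate_mateEquiv g)).mateEquiv_eq

end

section

open Functor.LaxMonoidal Functor.OplaxMonoidal

variable {D : Type u₁} [Category.{v} D] [MonoidalCategory D] (F : D ⥤ C) [F.Monoidal]

/-- A monoidal functor preserves exact pairings. -/
@[reducible] def mapExactPairing (X X' : D) [ExactPairing X X'] :
    ExactPairing (F.obj X) (F.obj X') where
  coevaluation' := ε F ≫ F.map (η_ X X') ≫ δ F X X'
  evaluation' := μ F X' X ≫ F.map (ε_ X X') ≫ η F
  coevaluation_evaluation' := by
    have h := congrArg (fun k => F.map k) (ExactPairing.coevaluation_evaluation X X')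
    simp only [Functor.map_comp, Functor.Monoidal.map_whiskerLeft,
      Functor.Monoidal.map_whiskerRight, Functor.Monoidal.map_associator_inv,
      Functor.Monoidal.map_rightUnitor, Functor.Monoidal.map_leftUnitor_inv, Category.assoc,
      Functor.Monoidal.μ_δ_assoc] at h
    have h' := congrArg
      (fun k => F.obj X' ◁ ε F ≫ μ F _ _ ≫ k ≫ δ F _ _ ≫ η F ▷ F.obj X') h
    simp only [Category.assoc, Functor.Monoidal.μ_δ_assoc, Functor.Monoidal.whiskerLeft_ε_η_assoc,
      Functor.Monoidal.whiskerRight_ε_η, Category.comp_id] at h'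
    simpa only [MonoidalCategory.whiskerLeft_comp, comp_whiskerRight, Category.assoc] using h'
  evaluation_coevaluation' := by
    have h := congrArg (fun k => F.map k) (ExactPairing.evaluation_coevaluation X X')
    simp only [Functor.map_comp, Functor.Monoidal.map_whiskerLeft,
      Functor.Monoidal.map_whiskerRight, Functor.Monoidal.map_associator,
      Functor.Monoidal.map_leftUnitor, Functor.Monoidal.map_rightUnitor_inv, Category.assoc,
      Functor.Monoidal.μ_δ_assoc] at h
    have h' := congrArg
      (fun k => ε F ▷ F.obj X ≫ μ F _ _ ≫ k ≫ δ F _ _ ≫ F.obj X ◁ η F) h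
    simp only [Category.assoc, Functor.Monoidal.μ_δ_assoc, Functor.Monoidal.whiskerRight_ε_η_assoc,
      Functor.Monoidal.whiskerLeft_ε_η, Category.comp_id] at h'
    simpa only [MonoidalCategory.whiskerLeft_comp, comp_whiskerRight, Category.assoc] using h'

lemma mapExactPairing_evaluation (X X' : D) [ExactPairing X X'] :
    letI := mapExactPairing F X X'
    ε_ (F.obj X) (F.obj X') = μ F X' X ≫ F.map (ε_ X X') ≫ η F := rfl

lemma IsMate.map {X X' Y Y' : D} [ExactPairing X X'] [ExactPairing Y Y'] {f : X ⟶ Y}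
    {m : Y' ⟶ X'} (h : IsMate f m) :
    letI := mapExactPairing F X X'
    letI := mapExactPairing F Y Y'
    IsMate (F.map f) (F.map m) := by
  have h' := congrArg (fun k => F.map k) h
  simp only [Functor.map_comp] at h'
  unfold IsMate
  rw [mapExactPairing_evaluation, mapExactPairing_evaluation, μ_natural_right_assoc,
    μ_natural_left_assoc, reassoc_of% h']

end

end Mate

section RigidCompact

variable {C : Type u} [Category.{v} C] [Preadditive C] [MonoidalCategory C] [SymmetricCategory C]
  [MonoidalClosed C]

omit [SymmetricCategory C] in
lemma RigidlyCompactlyGenerated.isCompactObj_right (hC : RigidlyCompactlyGenerated C) (x' x : C)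
    [ExactPairing x' x] : IsCompactObj x :=
  (hC.compact_iff_rigid x).2 (isRigid_of_exactPairing x' x)

lemma RigidlyCompactlyGenerated.isCompactObj_left (hC : RigidlyCompactlyGenerated C) (x' x : C)
    [ExactPairing x' x] : IsCompactObj x' :=
  letI := BraidedCategory.exactPairing_swap x' x
  hC.isCompactObj_right x x'

lemma RigidlyCompactlyGenerated.exists_leftDual (hC : RigidlyCompactlyGenerated C) {x : C}
    (hx : IsCompactObj x) : ∃ x', IsCompactObj x' ∧ Nonempty (ExactPairing x' x) := by
  obtain ⟨x', ⟨_⟩⟩ := ((hC.compact_iff_rigid x).1 hx).exists_exactPairing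
  exact ⟨x', hC.isCompactObj_left x' x, ⟨inferInstance⟩⟩

lemma RigidlyCompactlyGenerated.exists_rightDual (hC : RigidlyCompactlyGenerated C) {x : C}
    (hx : IsCompactObj x) : ∃ x', IsCompactObj x' ∧ Nonempty (ExactPairing x x') := by
  obtain ⟨x', hx', ⟨_⟩⟩ := hC.exists_leftDual hx
  exact ⟨x', hx', ⟨BraidedCategory.exactPairing_swap x' x⟩⟩

lemma RigidlyCompactlyGenerated.isCompactObj_unit (hC : RigidlyCompactlyGenerated C) :
    IsCompactObj (𝟙_ C) :=
  hC.isCompactObj_left (𝟙_ C) (𝟙_ C)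

lemma RigidlyCompactlyGenerated.isCompactObj_tensor (hC : RigidlyCompactlyGenerated C) {x y : C}
    (hx : IsCompactObj x) (hy : IsCompactObj y) : IsCompactObj (x ⊗ y) := by
  obtain ⟨x', _, ⟨_⟩⟩ := hC.exists_rightDual hx
  obtain ⟨y', _, ⟨_⟩⟩ := hC.exists_rightDual hy
  exact hC.isCompactObj_left (x ⊗ y) (y' ⊗ x')

end RigidCompact

section AdjunctionMaps

variable {A : Type u₁} {B : Type u₂} [Category.{v} A] [Category.{v} B] {L : A ⥤ B} {R : B ⥤ A}
  (adj : L ⊣ R)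

/-- The components of the unit of an adjunction. -/
def unitMap (a : A) : a ⟶ R.obj (L.obj a) := adj.unit.app a

/-- The components of the counit of an adjunction. -/
def counitMap (b : B) : L.obj (R.obj b) ⟶ b := adj.counit.app b

lemma homEquiv_eq_unitMap {a : A} {b : B} (f : L.obj a ⟶ b) :
    adj.homEquiv a b f = unitMap adj a ≫ R.map f :=
  adj.homEquiv_unit a b f

lemma homEquiv_symm_eq_counitMap {a : A} {b : B} (f : a ⟶ R.obj b) :
    (adj.homEquiv a b).symm f = L.map f ≫ counitMap adj b :=
  adj.homEquiv_counit a b f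

lemma unitMap_naturality {a a' : A} (f : a ⟶ a') :
    f ≫ unitMap adj a' = unitMap adj a ≫ R.map (L.map f) :=
  adj.unit.naturality f

lemma counitMap_naturality {b b' : B} (f : b ⟶ b') :
    L.map (R.map f) ≫ counitMap adj b' = counitMap adj b ≫ f :=
  adj.counit.naturality f

end AdjunctionMaps

section Adjoints

variable {D : Type u₁} {C : Type u₂} [Category.{v} D] [Preadditive D] [MonoidalCategory D]
  [SymmetricCategory D] [MonoidalClosed D]
  [Category.{v} C] [Preadditive C] [MonoidalCategory C] [SymmetricCategory C] [MonoidalClosed C]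
  {fstar : D ⥤ C} [fstar.Monoidal]

lemma isCompactObj_map (fstar : D ⥤ C) [fstar.Monoidal] (hD : RigidlyCompactlyGenerated D)
    (hC : RigidlyCompactlyGenerated C) {d : D} (hd : IsCompactObj d) :
    IsCompactObj (fstar.obj d) := by
  obtain ⟨d', _, ⟨_⟩⟩ := hD.exists_rightDual hd
  let := mapExactPairing fstar d d'
  exact hC.isCompactObj_left (fstar.obj d) (fstar.obj d')

/-- The dual of `f_* c'` corepresents `Hom(c, f^* -)` on compact objects. -/
lemma bijective_comp_map_of_isMate (hD : RigidlyCompactlyGenerated D)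
    {fpush : C ⥤ D} (adj1 : fstar ⊣ fpush) (c c' : C) [ExactPairing c c'] (L : D)
    [ExactPairing L (fpush.obj c')] (w : c ⟶ fstar.obj L)
    (hw : letI := mapExactPairing fstar L (fpush.obj c'); IsMate w (counitMap adj1 c'))
    {x : D} (hx : IsCompactObj x) :
    Function.Bijective fun h : L ⟶ x => w ≫ fstar.map h := by
  obtain ⟨x', _, ⟨_⟩⟩ := hD.exists_rightDual hx
  let := mapExactPairing fstar L (fpush.obj c')
  let := mapExactPairing fstar x x'
  rw [← Function.Bijective.of_comp_iff' (mateEquiv c c' (fstar.obj x) (fstar.obj x')).bijective]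
  have : (mateEquiv c c' (fstar.obj x) (fstar.obj x')) ∘ (fun h : L ⟶ x => w ≫ fstar.map h) =
      (adj1.homEquiv _ _).symm ∘ mateEquiv L (fpush.obj c') x x' := by
    ext h
    simp only [Function.comp_apply]
    rw [mateEquiv_comp (Y' := fstar.obj (fpush.obj c')), hw.mateEquiv_eq,
      ((isMate_mateEquiv h).map fstar).mateEquiv_eq, homEquiv_symm_eq_counitMap]
  rw [this]
  exact (Equiv.bijective _).comp (Equiv.bijective _)

lemma exists_isMate_counit {fpush : C ⥤ D} (adj1 : fstar ⊣ fpush) (c c' : C) [ExactPairing c c']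
    (L : D) [ExactPairing L (fpush.obj c')] :
    ∃ w : c ⟶ fstar.obj L,
      letI := mapExactPairing fstar L (fpush.obj c'); IsMate w (counitMap adj1 c') := by
  let := mapExactPairing fstar L (fpush.obj c')
  exact (IsMate.exists_unique_left (counitMap adj1 c')).exists

/-- A left adjoint of `f^*` is the conjugate of `f_*` under duality. -/
lemma exists_exactPairing_leftAdjoint (hD : RigidlyCompactlyGenerated D) {fpush : C ⥤ D}
    (adj1 : fstar ⊣ fpush) {f1 : C ⥤ D} (adj0 : f1 ⊣ fstar) (c c' : C) [ExactPairing c c']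
    (hf1 : IsCompactObj (f1.obj c)) (hg : IsCompactObj (fpush.obj c')) :
    ∃ _ : ExactPairing (f1.obj c) (fpush.obj c'),
      letI := mapExactPairing fstar (f1.obj c) (fpush.obj c')
      IsMate (unitMap adj0 c) (counitMap adj1 c') := by
  obtain ⟨L, hL, ⟨_⟩⟩ := hD.exists_leftDual hg
  obtain ⟨w, hw⟩ := exists_isMate_counit adj1 c c' L
  have key {x : D} (hx : IsCompactObj x) : Function.Bijective
      fun h : L ⟶ x => (adj0.homEquiv _ _).symm w ≫ h := by
    rw [← Function.Bijective.of_comp_iff' (adj0.homEquiv c x).bijective]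
    convert bijective_comp_map_of_isMate hD adj1 c c' L w hw hx using 1
    ext h
    simp [Adjunction.homEquiv_naturality_right]
  have : IsIso ((adj0.homEquiv _ _).symm w) := by
    obtain ⟨s, hs⟩ := (key hf1).2 (𝟙 _)
    dsimp only at hs
    exact ⟨s, hs, (key hL).1 (by simp [reassoc_of% hs])⟩
  refine ⟨exactPairingCongrLeft (asIso ((adj0.homEquiv _ _).symm w)), ?_⟩
  have hu : unitMap adj0 c ≫ fstar.map ((adj0.homEquiv _ _).symm w) = w := by
    rw [← homEquiv_eq_unitMap, Equiv.apply_symm_apply]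
  unfold IsMate at hw ⊢
  rw [mapExactPairing_evaluation] at hw ⊢
  rw [← hw]
  conv_rhs => rw [← hu]
  rw [MonoidalCategory.whiskerLeft_comp, Category.assoc,
    Functor.LaxMonoidal.μ_natural_right_assoc, ← Functor.map_comp_assoc]
  rfl

end Adjoints

section Dichotomy

variable {D : Type u₁} {C : Type u₂}
  [Category.{v} D] [Preadditive D] [HasZeroObject D] [HasShift D ℤ]
  [∀ n : ℤ, (shiftFunctor D n).Additive] [Pretriangulated D]
  [MonoidalCategory D] [SymmetricCategory D] [MonoidalClosed D]
  [Category.{v} C] [Preadditive C] [HasZeroObject C] [HasShift C ℤ]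
  [∀ n : ℤ, (shiftFunctor C n).Additive] [Pretriangulated C]
  [MonoidalCategory C] [SymmetricCategory C] [MonoidalClosed C]
  [HasCoproducts.{v} D] [HasCoproducts.{v} C]
  {fstar : D ⥤ C} [fstar.Monoidal]

lemma isRightAdjoint_of_isCompactObj_map [fstar.CommShift ℤ] [fstar.IsTriangulated]
    (hD : RigidlyCompactlyGenerated D)
    (hC : RigidlyCompactlyGenerated C) (hcop : PreservesCoproducts fstar) {fpush : C ⥤ D}
    (adj1 : fstar ⊣ fpush) (hg : ∀ c, IsCompactObj c → IsCompactObj (fpush.obj c)) :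
    fstar.IsRightAdjoint := by
  refine isRightAdjoint_of_compact fstar hD.exists_generators hC.exists_generators hcop
    fun c hc => ?_
  obtain ⟨c', hc', ⟨_⟩⟩ := hC.exists_rightDual hc
  obtain ⟨L, hL, ⟨_⟩⟩ := hD.exists_leftDual (hg c' hc')
  obtain ⟨w, hw⟩ := exists_isMate_counit adj1 c c' L
  exact ⟨L, w, hL, fun x hx => bijective_comp_map_of_isMate hD adj1 c c' L w hw hx⟩

lemma isCompactObj_map_of_leftAdjoint (hD : RigidlyCompactlyGenerated D)
    (hC : RigidlyCompactlyGenerated C) {fpush : C ⥤ D}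
    (adj1 : fstar ⊣ fpush) {f1 : C ⥤ D} (adj0 : f1 ⊣ fstar)
    (hf1 : ∀ c, IsCompactObj c → IsCompactObj (f1.obj c)) {c : C} (hc : IsCompactObj c) :
    IsCompactObj (fpush.obj c) := by
  obtain ⟨c', hc', ⟨_⟩⟩ := hC.exists_rightDual hc
  obtain ⟨E, hE, ⟨_⟩⟩ := hD.exists_leftDual (hf1 c' hc')
  let := mapExactPairing fstar E (f1.obj c')
  obtain ⟨b, hb, -⟩ := IsMate.exists_unique_left (X := fstar.obj E) (Y := c) (unitMap adj0 c')
  have : IsIso (adj1.homEquiv _ _ b) := by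
    refine isIso_of_bijective_of_isCompactObj hD.exists_generators _ fun d hd => ?_
    obtain ⟨d', hd', ⟨_⟩⟩ := hD.exists_rightDual hd
    let := mapExactPairing fstar d d'
    have : (fun k : d ⟶ E => k ≫ adj1.homEquiv _ _ b) =
        adj1.homEquiv _ _ ∘ (mateEquiv (fstar.obj d) (fstar.obj d') c c').symm ∘
          adj0.homEquiv _ _ ∘ mateEquiv d d' E (f1.obj c') := by
      ext k
      simp only [Function.comp_apply]
      rw [← Adjunction.homEquiv_naturality_left]
      congr 1
      rw [Equiv.eq_symm_apply, mateEquiv_comp (Y' := fstar.obj (f1.obj c')), hb.mateEquiv_eq,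
        ((isMate_mateEquiv k).map fstar).mateEquiv_eq, homEquiv_eq_unitMap]
    rw [this]
    exact (Equiv.bijective _).comp ((Equiv.bijective _).comp ((Equiv.bijective _).comp
      (Equiv.bijective _)))
  exact hE.of_iso (asIso (adj1.homEquiv _ _ b))

end Dichotomy

section DualizingObject

variable {D : Type u₁} {C : Type u₂} [Category.{v} D] [MonoidalCategory D]
  [Category.{v} C] [MonoidalCategory C] {fstar : D ⥤ C} [fstar.Monoidal]

lemma IsMate.map_leftAdjoint {fpush : C ⥤ D} (adj1 : fstar ⊣ fpush) {f1 : C ⥤ D}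
    (adj0 : f1 ⊣ fstar) {a a' b b' : C} [ExactPairing a a'] [ExactPairing b b']
    [ExactPairing (f1.obj a) (fpush.obj a')] [ExactPairing (f1.obj b) (fpush.obj b')]
    (ha : letI := mapExactPairing fstar (f1.obj a) (fpush.obj a')
      IsMate (unitMap adj0 a) (counitMap adj1 a'))
    (hb : letI := mapExactPairing fstar (f1.obj b) (fpush.obj b')
      IsMate (unitMap adj0 b) (counitMap adj1 b'))
    {f : a ⟶ b} {m : b' ⟶ a'} (h : IsMate f m) :
    IsMate (f1.map f) (fpush.map m) := by
  let := mapExactPairing fstar (f1.obj a) (fpush.obj a')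
  let := mapExactPairing fstar (f1.obj b) (fpush.obj b')
  rw [← mateEquiv_eq_iff]
  apply (adj1.homEquiv _ _).symm.injective
  rw [homEquiv_symm_eq_counitMap, homEquiv_symm_eq_counitMap, counitMap_naturality]
  rw [← (ha.comp ((isMate_mateEquiv (f1.map f)).map fstar)).mateEquiv_eq,
    ← (h.comp hb).mateEquiv_eq, unitMap_naturality]

end DualizingObject

section

variable {D : Type u₁} {C : Type u₂}
  [Category.{v} D] [Preadditive D]
  [MonoidalCategory D] [SymmetricCategory D] [MonoidalClosed D]
  [Category.{v} C] [Preadditive C] [HasZeroObject C] [HasShift C ℤ]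
  [∀ n : ℤ, (shiftFunctor C n).Additive] [Pretriangulated C]
  [MonoidalCategory C] [SymmetricCategory C] [MonoidalClosed C]
  [HasCoproducts.{v} C]
  {fstar : D ⥤ C} [fstar.Monoidal]

/-- If the left adjoint of `f^*` has a left adjoint preserving compact objects, then the
relative dualizing object is compact. -/
lemma isCompactObj_fone_unit_of_leftAdjoint (hD : RigidlyCompactlyGenerated D)
    (hC : RigidlyCompactlyGenerated C) {fpush : C ⥤ D} (adj1 : fstar ⊣ fpush)
    {fone : D ⥤ C} (adj2 : fpush ⊣ fone) {f1 : C ⥤ D} (adj0 : f1 ⊣ fstar) {k : D ⥤ C}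
    (adjk : k ⊣ f1) (hk : IsCompactObj (k.obj (𝟙_ D)))
    (hf1 : ∀ c, IsCompactObj c → IsCompactObj (f1.obj c))
    (hg : ∀ c, IsCompactObj c → IsCompactObj (fpush.obj c)) :
    IsCompactObj (fone.obj (𝟙_ D)) := by
  obtain ⟨τ', hτ', ⟨_⟩⟩ := hC.exists_rightDual hk
  obtain ⟨pτ, hpτ⟩ := exists_exactPairing_leftAdjoint hD adj1 adj0 _ τ' (hf1 _ hk) (hg _ hτ')
  let ϖ : fpush.obj τ' ⟶ 𝟙_ D := mateEquiv (𝟙_ D) (𝟙_ D) (f1.obj (k.obj (𝟙_ D)))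
    (fpush.obj τ') (unitMap adjk (𝟙_ D))
  have : IsIso (adj2.homEquiv _ _ ϖ) := by
    refine isIso_of_bijective_of_isCompactObj hC.exists_generators _ fun c' hc' => ?_
    obtain ⟨c, hc, ⟨_⟩⟩ := hC.exists_leftDual hc'
    obtain ⟨pc, hpc⟩ := exists_exactPairing_leftAdjoint hD adj1 adj0 c c' (hf1 _ hc) (hg _ hc')
    have : (fun m : c' ⟶ τ' => m ≫ adj2.homEquiv _ _ ϖ) =
        adj2.homEquiv _ _ ∘ mateEquiv (𝟙_ D) (𝟙_ D) (f1.obj c) (fpush.obj c') ∘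
          adjk.homEquiv _ _ ∘ (mateEquiv (k.obj (𝟙_ D)) τ' c c').symm := by
      ext m
      obtain ⟨m', rfl⟩ := (mateEquiv (k.obj (𝟙_ D)) τ' c c').surjective m
      simp only [Function.comp_apply, Equiv.symm_apply_apply]
      rw [← Adjunction.homEquiv_naturality_left, homEquiv_eq_unitMap adjk,
        mateEquiv_comp (Y' := fpush.obj τ'),
        (IsMate.map_leftAdjoint adj1 adj0 hpτ hpc (isMate_mateEquiv m')).mateEquiv_eq]
    rw [this]
    exact (Equiv.bijective _).comp ((Equiv.bijective _).comp ((Equiv.bijective _).comp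
      (Equiv.bijective _)))
  exact hτ'.of_iso (asIso (adj2.homEquiv _ _ ϖ))

end

section Extension

variable {A : Type u₁} {B : Type u₂} [Category.{v} A] [Preadditive A]
  [Category.{v} B] [Preadditive B] [HasZeroObject B] [HasShift B ℤ]
  [∀ n : ℤ, (shiftFunctor B n).Additive] [Pretriangulated B] [HasCoproducts.{v} B]

/-- A natural transformation between right adjoints whose left adjoints preserve compact
objects is invertible if it is so at compact objects. -/
lemma isIso_app_of_isCompactObj (hB : HasCompactGenerators B) {F₁ F₂ : A ⥤ B} {L₁ L₂ : B ⥤ A}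
    (adj₁ : L₁ ⊣ F₁) (adj₂ : L₂ ⊣ F₂) (h₁ : ∀ b, IsCompactObj b → IsCompactObj (L₁.obj b))
    (h₂ : ∀ b, IsCompactObj b → IsCompactObj (L₂.obj b)) (α : F₁ ⟶ F₂)
    (hα : ∀ a, IsCompactObj a → IsIso (α.app a)) (a : A) : IsIso (α.app a) := by
  refine isIso_of_bijective_of_isCompactObj hB _ fun b hb => ?_
  let β : L₂.obj b ⟶ L₁.obj b := (adj₂.homEquiv _ _).symm (unitMap adj₁ b ≫ α.app (L₁.obj b))
  have key {a : A} : (fun f : L₁.obj b ⟶ a => β ≫ f) =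
      (adj₂.homEquiv b a).symm ∘ (fun g => g ≫ α.app a) ∘ adj₁.homEquiv b a := by
    ext f
    simp only [Function.comp_apply]
    rw [Equiv.eq_symm_apply, Adjunction.homEquiv_naturality_right, Equiv.apply_symm_apply,
      homEquiv_eq_unitMap, Category.assoc, Category.assoc, α.naturality]
  have hβ {a : A} (ha : IsCompactObj a) : Function.Bijective fun f : L₁.obj b ⟶ a => β ≫ f := by
    have := hα a ha
    rw [key]
    refine (Equiv.bijective _).comp (Function.Bijective.comp ?_ (Equiv.bijective _))
    exact ⟨fun x y h => (cancel_mono (α.app a)).1 h, fun x => ⟨x ≫ inv (α.app a), by simp⟩⟩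
  have : IsIso β := by
    obtain ⟨t, ht⟩ := (hβ (h₂ b hb)).2 (𝟙 _)
    dsimp only at ht
    refine ⟨t, ht, (hβ (h₁ b hb)).1 ?_⟩
    simp [reassoc_of% ht]
  have hb : Function.Bijective fun f : L₁.obj b ⟶ a => β ≫ f :=
    ⟨fun x y h => (cancel_epi β).1 h, fun x => ⟨inv β ≫ x, by simp⟩⟩
  rw [key, Function.Bijective.of_comp_iff' (Equiv.bijective _),
    Function.Bijective.of_comp_iff _ (Equiv.bijective _)] at hb
  exact hb

end Extension

section Projection

open Functor.LaxMonoidal Functor.OplaxMonoidal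

variable {D : Type u₁} {C : Type u₂} [Category.{v} D] [MonoidalCategory D]
  [Category.{v} C] [MonoidalCategory C] {fstar : D ⥤ C} [fstar.Monoidal]
  {fpush : C ⥤ D} (adj1 : fstar ⊣ fpush)

lemma homEquiv_symm_projFormula (x : D) (y : C) :
    (adj1.homEquiv _ _).symm (projFormula fstar fpush adj1 x y) =
      δ fstar x (fpush.obj y) ≫ fstar.obj x ◁ counitMap adj1 y :=
  Equiv.symm_apply_apply _ _

lemma homEquiv_symm_comp_projFormula {d x : D} {y : C} (k : d ⟶ x ⊗ fpush.obj y) :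
    (adj1.homEquiv _ _).symm (k ≫ projFormula fstar fpush adj1 x y) =
      fstar.map k ≫ δ fstar x (fpush.obj y) ≫ fstar.obj x ◁ counitMap adj1 y := by
  rw [Adjunction.homEquiv_naturality_left_symm, homEquiv_symm_projFormula]

lemma homEquiv_symm_comp_projFormula_comp {d x : D} {y z : C} (k : d ⟶ x ⊗ fpush.obj y)
    (r : fstar.obj x ⊗ y ⟶ z) :
    (adj1.homEquiv _ _).symm (k ≫ projFormula fstar fpush adj1 x y ≫ fpush.map r) =
      fstar.map k ≫ δ fstar x (fpush.obj y) ≫ fstar.obj x ◁ counitMap adj1 y ≫ r := by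
  rw [← Category.assoc, Adjunction.homEquiv_naturality_right_symm,
    homEquiv_symm_comp_projFormula, Category.assoc, Category.assoc]

lemma projFormula_naturality_left {x₁ x₂ : D} (m : x₁ ⟶ x₂) (y : C) :
    m ▷ fpush.obj y ≫ projFormula fstar fpush adj1 x₂ y =
      projFormula fstar fpush adj1 x₁ y ≫ fpush.map (fstar.map m ▷ y) := by
  apply (adj1.homEquiv _ _).symm.injective
  rw [homEquiv_symm_comp_projFormula, Adjunction.homEquiv_naturality_right_symm,
    homEquiv_symm_projFormula, Category.assoc, whisker_exchange, δ_natural_left_assoc]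

lemma projFormula_naturality_right (x : D) {y₁ y₂ : C} (n : y₁ ⟶ y₂) :
    x ◁ fpush.map n ≫ projFormula fstar fpush adj1 x y₂ =
      projFormula fstar fpush adj1 x y₁ ≫ fpush.map (fstar.obj x ◁ n) := by
  apply (adj1.homEquiv _ _).symm.injective
  rw [homEquiv_symm_comp_projFormula, Adjunction.homEquiv_naturality_right_symm,
    homEquiv_symm_projFormula, Category.assoc, ← MonoidalCategory.whiskerLeft_comp,
    ← counitMap_naturality, MonoidalCategory.whiskerLeft_comp, δ_natural_right_assoc]

/-- The projection formula morphisms are compatible with contraction. -/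
lemma whiskerLeft_projFormula_comp {x x' : D} (e : x' ⊗ x ⟶ 𝟙_ D) (y : C) :
    x' ◁ projFormula fstar fpush adj1 x y ≫ projFormula fstar fpush adj1 x' (fstar.obj x ⊗ y) ≫
      fpush.map ((α_ _ _ _).inv ≫ (μ fstar x' x ≫ fstar.map e ≫ η fstar) ▷ y ≫ (λ_ y).hom) =
    (α_ _ _ _).inv ≫ e ▷ fpush.obj y ≫ (λ_ _).hom := by
  apply (adj1.homEquiv _ _).symm.injective
  rw [homEquiv_symm_comp_projFormula_comp, ← δ_natural_right_assoc,
    ← MonoidalCategory.whiskerLeft_comp_assoc, ← homEquiv_symm_eq_counitMap,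
    homEquiv_symm_projFormula, homEquiv_symm_eq_counitMap]
  simp only [Functor.map_comp, Functor.Monoidal.map_whiskerRight,
    Functor.Monoidal.map_associator_inv, Functor.Monoidal.map_leftUnitor, Category.assoc,
    Functor.Monoidal.μ_δ_assoc, MonoidalCategory.whiskerLeft_comp, comp_whiskerRight]
  rw [← leftUnitor_naturality, ← whisker_exchange_assoc, ← whisker_exchange_assoc,
    ← whisker_exchange_assoc]
  simp

/-- The projection formula holds for objects with a dual. -/
lemma isIso_projFormula (x x' : D) [ExactPairing x x'] (y : C) :
    IsIso (projFormula fstar fpush adj1 x y) := by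
  refine isIso_of_bijective_comp _ fun d => ?_
  let := mapExactPairing fstar x x'
  let r : fstar.obj x' ⊗ fstar.obj x ⊗ y ⟶ y :=
    (α_ _ _ _).inv ≫ (μ fstar x' x ≫ fstar.map (ε_ x x') ≫ η fstar) ▷ y ≫ (λ_ y).hom
  let Ψ : (d ⟶ fpush.obj (fstar.obj x ⊗ y)) → (x' ⊗ d ⟶ fpush.obj y) := fun m =>
    x' ◁ m ≫ projFormula fstar fpush adj1 x' (fstar.obj x ⊗ y) ≫ fpush.map r
  have hΨ : Function.Bijective Ψ := by
    have h : (adj1.homEquiv _ _).symm ∘ Ψ = (fun k => δ fstar x' d ≫ k) ∘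
        (tensorLeftHomEquiv (fstar.obj d) (fstar.obj x) (fstar.obj x') y).symm ∘
          (adj1.homEquiv _ _).symm := by
      ext m
      simp only [Function.comp_apply, Ψ]
      rw [homEquiv_symm_comp_projFormula_comp, ← δ_natural_right_assoc,
        ← MonoidalCategory.whiskerLeft_comp_assoc, ← homEquiv_symm_eq_counitMap,
        tensorLeftHomEquiv_symm_apply, mapExactPairing_evaluation]
    rw [← Function.Bijective.of_comp_iff' (adj1.homEquiv (x' ⊗ d) y).symm.bijective, h]
    refine Function.Bijective.comp ?_ ((Equiv.bijective _).comp (Equiv.bijective _))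
    exact ⟨fun a b h => (cancel_epi (δ fstar x' d)).1 h, fun a => ⟨μ fstar x' d ≫ a, by simp⟩⟩
  rw [← Function.Bijective.of_comp_iff' hΨ]
  have h : Ψ ∘ (fun g : d ⟶ x ⊗ fpush.obj y => g ≫ projFormula fstar fpush adj1 x y) =
      (tensorLeftHomEquiv d x x' (fpush.obj y)).symm := by
    ext g
    simp only [Function.comp_apply, Ψ, r]
    rw [MonoidalCategory.whiskerLeft_comp, Category.assoc, whiskerLeft_projFormula_comp,
      tensorLeftHomEquiv_symm_apply]
  rw [h]
  exact Equiv.bijective _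

end Projection

section Twist

open Functor.LaxMonoidal Functor.OplaxMonoidal

section

variable {D : Type u₁} {C : Type u₂} [Category.{v} D] [MonoidalCategory D]
  [Category.{v} C] [MonoidalCategory C] {fstar : D ⥤ C} [fstar.Monoidal]
  {fpush : C ⥤ D} (adj1 : fstar ⊣ fpush)

/-- The projection formula morphisms, as a natural transformation in the first variable. -/
@[simps]
def projFormulaNatTrans (y : C) :
    tensorRight (fpush.obj y) ⟶ fstar ⋙ tensorRight y ⋙ fpush where
  app x := projFormula fstar fpush adj1 x y
  naturality _ _ m := projFormula_naturality_left adj1 m y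

variable {fone : D ⥤ C} (adj2 : fpush ⊣ fone)

/-- The transpose of the comparison morphism `f^* x ⊗ f^(1) 𝟙 ⟶ f^(1) x`. -/
def twistTranspose (x : D) [IsIso (projFormula fstar fpush adj1 x (fone.obj (𝟙_ D)))] :
    fpush.obj (fstar.obj x ⊗ fone.obj (𝟙_ D)) ⟶ x :=
  inv (projFormula fstar fpush adj1 x (fone.obj (𝟙_ D))) ≫
    x ◁ counitMap adj2 (𝟙_ D) ≫ (ρ_ x).hom

/-- The comparison morphism `f^* x ⊗ f^(1) 𝟙 ⟶ f^(1) x`. -/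
@[simps]
def twistNatTrans [∀ x, IsIso (projFormula fstar fpush adj1 x (fone.obj (𝟙_ D)))] :
    fstar ⋙ tensorRight (fone.obj (𝟙_ D)) ⟶ fone where
  app x := adj2.homEquiv _ _ (twistTranspose adj1 adj2 x)
  naturality x y m := by
    apply (adj2.homEquiv _ _).symm.injective
    refine (Adjunction.homEquiv_naturality_left_symm _ _ _).trans ?_
    rw [Adjunction.homEquiv_naturality_right_symm, Equiv.symm_apply_apply, Equiv.symm_apply_apply]
    dsimp [twistTranspose]
    rw [← cancel_epi (projFormula fstar fpush adj1 x (fone.obj (𝟙_ D))),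
      ← reassoc_of% (projFormula_naturality_left adj1 m (fone.obj (𝟙_ D)))]
    simp only [IsIso.hom_inv_id_assoc, Category.assoc]
    rw [← whisker_exchange_assoc, rightUnitor_naturality]

lemma isIso_homEquiv_twistTranspose (x x' : D) [ExactPairing x x'] [ExactPairing x' x]
    [IsIso (projFormula fstar fpush adj1 x (fone.obj (𝟙_ D)))] :
    IsIso (adj2.homEquiv _ _ (twistTranspose adj1 adj2 x)) := by
  refine isIso_of_bijective_comp _ fun c => ?_
  let := mapExactPairing fstar x x'
  have := isIso_projFormula adj1 x' x c
  rw [← Function.Bijective.of_comp_iff' (adj2.homEquiv c x).symm.bijective,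
    ← Function.Bijective.of_comp_iff' (bijective_whiskerLeft_comp_evaluation (fpush.obj c) x x')]
  have h : (fun h : fpush.obj c ⟶ x => x' ◁ h ≫ ε_ x x') ∘ (adj2.homEquiv c x).symm ∘
      (fun a => a ≫ adj2.homEquiv _ _ (twistTranspose adj1 adj2 x)) =
      (fun k => projFormula fstar fpush adj1 x' c ≫ k) ∘ (adj2.homEquiv _ _).symm ∘
        (tensorLeftHomEquiv c (fstar.obj x) (fstar.obj x') (fone.obj (𝟙_ D))).symm := by
    ext a
    simp only [Function.comp_apply]
    rw [Adjunction.homEquiv_naturality_left_symm, Equiv.symm_apply_apply,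
      homEquiv_symm_eq_counitMap, tensorLeftHomEquiv_symm_apply, mapExactPairing_evaluation,
      Functor.map_comp, Category.assoc,
      ← reassoc_of% (projFormula_naturality_right adj1 x' a),
      MonoidalCategory.whiskerLeft_comp, Category.assoc]
    congr 1
    rw [← cancel_epi (x' ◁ projFormula fstar fpush adj1 x (fone.obj (𝟙_ D)))]
    rw [reassoc_of% (whiskerLeft_projFormula_comp adj1 (ε_ x x') (fone.obj (𝟙_ D)))]
    dsimp [twistTranspose]
    rw [← MonoidalCategory.whiskerLeft_comp_assoc, IsIso.hom_inv_id_assoc,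
      ← leftUnitor_naturality, ← whisker_exchange_assoc]
    simp [unitors_equal]
  rw [h]
  refine Function.Bijective.comp ?_ ((Equiv.bijective _).comp (Equiv.bijective _))
  exact ⟨fun a b h => (cancel_epi (projFormula fstar fpush adj1 x' c)).1 h,
    fun a => ⟨inv (projFormula fstar fpush adj1 x' c) ≫ a, by simp⟩⟩

end

variable {D : Type u₁} {C : Type u₂}
  [Category.{v} D] [Preadditive D] [HasZeroObject D] [HasShift D ℤ]
  [∀ n : ℤ, (shiftFunctor D n).Additive] [Pretriangulated D]
  [MonoidalCategory D] [SymmetricCategory D] [MonoidalClosed D]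
  [Category.{v} C] [Preadditive C] [HasZeroObject C] [HasShift C ℤ]
  [∀ n : ℤ, (shiftFunctor C n).Additive] [Pretriangulated C]
  [MonoidalCategory C] [SymmetricCategory C] [MonoidalClosed C]
  [HasCoproducts.{v} C] [HasCoproducts.{v} D]
  {fstar : D ⥤ C} [fstar.Monoidal]

/-- If `f^*` has a left adjoint preserving compact objects, then the projection formula holds
for compact objects in the second variable. -/
lemma isIso_projFormula_of_leftAdjoint (hD : RigidlyCompactlyGenerated D)
    (hC : RigidlyCompactlyGenerated C) {fpush : C ⥤ D} (adj1 : fstar ⊣ fpush)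
    {f1 : C ⥤ D} (adj0 : f1 ⊣ fstar) (hf1 : ∀ c, IsCompactObj c → IsCompactObj (f1.obj c))
    (hg : ∀ c, IsCompactObj c → IsCompactObj (fpush.obj c)) {y : C} (hy : IsCompactObj y)
    (x : D) : IsIso (projFormula fstar fpush adj1 x y) := by
  obtain ⟨y', hy', ⟨_⟩⟩ := hC.exists_leftDual hy
  obtain ⟨z, hz, ⟨_⟩⟩ := hD.exists_leftDual (hg y hy)
  refine isIso_app_of_isCompactObj hD.exists_generators
    (tensorRightAdjunction z (fpush.obj y))
    ((adj1.comp (tensorRightAdjunction y' y)).comp adj0) ?_ ?_ (projFormulaNatTrans adj1 y) ?_ x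
  · exact fun b hb => hD.isCompactObj_tensor hb hz
  · exact fun b hb => hf1 _ (hC.isCompactObj_tensor (isCompactObj_map fstar hD hC hb) hy')
  · intro a ha
    obtain ⟨a', _, ⟨_⟩⟩ := hD.exists_rightDual ha
    exact isIso_projFormula adj1 a a' y

/-- If the relative dualizing object is compact, then `f^(1)` is a twist of `f^*`. -/
lemma nonempty_iso_fone (hD : RigidlyCompactlyGenerated D)
    (hC : RigidlyCompactlyGenerated C) {fpush : C ⥤ D} (adj1 : fstar ⊣ fpush)
    {fone : D ⥤ C} (adj2 : fpush ⊣ fone)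
    {f1 : C ⥤ D} (adj0 : f1 ⊣ fstar) (hf1 : ∀ c, IsCompactObj c → IsCompactObj (f1.obj c))
    (hg : ∀ c, IsCompactObj c → IsCompactObj (fpush.obj c))
    (hω : IsCompactObj (fone.obj (𝟙_ D))) :
    Nonempty (fstar ⋙ tensorRight (fone.obj (𝟙_ D)) ≅ fone) := by
  have := isIso_projFormula_of_leftAdjoint hD hC adj1 adj0 hf1 hg hω
  obtain ⟨ω', hω', ⟨_⟩⟩ := hC.exists_leftDual hω
  have (x : D) : IsIso ((twistNatTrans adj1 adj2).app x) := by
    refine isIso_app_of_isCompactObj hC.exists_generators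
      ((tensorRightAdjunction ω' (fone.obj (𝟙_ D))).comp adj0) adj2 ?_ hg
      (twistNatTrans adj1 adj2) ?_ x
    · exact fun b hb => hf1 _ (hC.isCompactObj_tensor hb hω')
    · intro a ha
      obtain ⟨a', _, ⟨_⟩⟩ := hD.exists_rightDual ha
      let := BraidedCategory.exactPairing_swap a a'
      exact isIso_homEquiv_twistTranspose adj1 adj2 a a'
  have := NatIso.isIso_of_isIso_app (twistNatTrans adj1 adj2)
  exact ⟨asIso (twistNatTrans adj1 adj2)⟩

end Twist

section Invertible

open Functor.LaxMonoidal Functor.OplaxMonoidal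

/-- A pairing which is perfect in the first variable is perfect in the second one, as soon as
the second object has a dual. -/
lemma bijective_whiskerLeft_comp_of_bijective {D : Type u₁} [Category.{v} D] [MonoidalCategory D]
    {A B E : D} [ExactPairing B E] (P : A ⊗ B ⟶ 𝟙_ D)
    (hP : ∀ d, Function.Bijective fun m : d ⟶ A => m ▷ B ≫ P) (X : D) :
    Function.Bijective fun n : X ⟶ B => A ◁ n ≫ P := by
  obtain ⟨θ, hθ⟩ := (bijective_whiskerRight_comp_evaluation B E A).2 P
  dsimp only at hθ
  have : IsIso θ := by
    refine isIso_of_bijective_comp _ fun d => ?_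
    rw [← Function.Bijective.of_comp_iff' (bijective_whiskerRight_comp_evaluation B E d)]
    convert hP d using 1
    ext m
    simp [hθ]
  have : (fun n : X ⟶ B => A ◁ n ≫ P) = (fun k => θ ▷ X ≫ k) ∘ fun n => E ◁ n ≫ ε_ B E := by
    ext n
    simp only [Function.comp_apply]
    rw [← whisker_exchange_assoc, hθ]
  rw [this]
  refine Function.Bijective.comp ?_ (bijective_whiskerLeft_comp_evaluation X B E)
  exact ⟨fun a b h => (cancel_epi (θ ▷ X)).1 h, fun a => ⟨inv (θ ▷ X) ≫ a, by simp⟩⟩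

section

variable {D : Type u₁} {C : Type u₂} [Category.{v} D] [MonoidalCategory D]
  [Category.{v} C] [MonoidalCategory C] {fstar : D ⥤ C} [fstar.Monoidal]
  {fpush : C ⥤ D} (adj1 : fstar ⊣ fpush) {fone : D ⥤ C} (adj2 : fpush ⊣ fone)

/-- The pairing between `f_* (ω ⊗ c)` and `f_* c'`, where `ω = f^(1) 𝟙` and `c'` is dual
to `c`. -/
def pushPairing (c' c : C) [ExactPairing c' c] :
    fpush.obj (fone.obj (𝟙_ D) ⊗ c) ⊗ fpush.obj c' ⟶ 𝟙_ D :=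
  projFormula fstar fpush adj1 _ c' ≫
    fpush.map (counitMap adj1 _ ▷ c' ≫ (α_ _ _ _).hom ≫ _ ◁ ε_ c' c ≫ (ρ_ _).hom) ≫
      counitMap adj2 (𝟙_ D)

lemma bijective_whiskerRight_comp_pushPairing (c' c : C) [ExactPairing c' c] (d : D)
    [IsIso (projFormula fstar fpush adj1 d c')] :
    Function.Bijective fun m : d ⟶ fpush.obj (fone.obj (𝟙_ D) ⊗ c) =>
      m ▷ fpush.obj c' ≫ pushPairing adj1 adj2 c' c := by
  have h : (fun m : d ⟶ fpush.obj (fone.obj (𝟙_ D) ⊗ c) =>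
      m ▷ fpush.obj c' ≫ pushPairing adj1 adj2 c' c) =
      (fun k => projFormula fstar fpush adj1 d c' ≫ k) ∘ (adj2.homEquiv _ _).symm ∘
        (tensorRightHomEquiv (fstar.obj d) c' c (fone.obj (𝟙_ D))).symm ∘
          (adj1.homEquiv _ _).symm := by
    ext m
    simp only [Function.comp_apply]
    rw [homEquiv_symm_eq_counitMap, homEquiv_symm_eq_counitMap, tensorRightHomEquiv_symm_apply,
      pushPairing, reassoc_of% (projFormula_naturality_left adj1 m c'), ← Functor.map_comp_assoc,
      ← comp_whiskerRight_assoc]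
  rw [h]
  refine Function.Bijective.comp ?_
    ((Equiv.bijective _).comp ((Equiv.bijective _).comp (Equiv.bijective _)))
  exact ⟨fun a b h => (cancel_epi (projFormula fstar fpush adj1 d c')).1 h,
    fun a => ⟨inv (projFormula fstar fpush adj1 d c') ≫ a, by simp⟩⟩

lemma whiskerLeft_comp_pushPairing (c' c : C) [ExactPairing c' c] (n : 𝟙_ D ⟶ fpush.obj c')
    (k : c ⟶ 𝟙_ C)
    (hk : c ◁ (adj1.homEquiv _ _).symm n ≫ ε_ c' c = c ◁ η fstar ≫ (ρ_ c).hom ≫ k) :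
    fpush.obj (fone.obj (𝟙_ D) ⊗ c) ◁ n ≫ pushPairing adj1 adj2 c' c =
      (ρ_ _).hom ≫ (adj2.homEquiv _ _).symm (fone.obj (𝟙_ D) ◁ k ≫ (ρ_ _).hom) := by
  have h : fpush.obj (fone.obj (𝟙_ D) ⊗ c) ◁ n ≫ projFormula fstar fpush adj1 _ c' ≫
      fpush.map (counitMap adj1 _ ▷ c' ≫ (α_ _ _ _).hom ≫ _ ◁ ε_ c' c ≫ (ρ_ _).hom) =
      (ρ_ _).hom ≫ fpush.map (fone.obj (𝟙_ D) ◁ k ≫ (ρ_ _).hom) := by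
    apply (adj1.homEquiv _ _).symm.injective
    rw [homEquiv_symm_comp_projFormula_comp, ← δ_natural_right_assoc,
      ← MonoidalCategory.whiskerLeft_comp_assoc, ← homEquiv_symm_eq_counitMap,
      whisker_exchange_assoc, associator_naturality_right_assoc,
      ← MonoidalCategory.whiskerLeft_comp_assoc, hk, homEquiv_symm_eq_counitMap,
      Functor.map_comp, Category.assoc, counitMap_naturality, Functor.Monoidal.map_rightUnitor]
    simp only [MonoidalCategory.whiskerLeft_comp, Category.assoc]
    rw [← associator_naturality_right_assoc, ← whisker_exchange_assoc]
    simp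
  rw [pushPairing, reassoc_of% h, homEquiv_symm_eq_counitMap]

include adj2 in
lemma bijective_whiskerLeft_fone_unit (c' c : C) [ExactPairing c' c] (E : D)
    [ExactPairing (fpush.obj c') E]
    (hπ : ∀ d, IsIso (projFormula fstar fpush adj1 d c')) :
    Function.Bijective fun k : c ⟶ 𝟙_ C => fone.obj (𝟙_ D) ◁ k ≫ (ρ_ _).hom := by
  have hP := bijective_whiskerLeft_comp_of_bijective (E := E) (pushPairing adj1 adj2 c' c)
    (fun d => bijective_whiskerRight_comp_pushPairing adj1 adj2 c' c d) (𝟙_ D)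
  let Q : (𝟙_ D ⟶ fpush.obj c') → (c ⟶ 𝟙_ C) := fun n =>
    (ρ_ c).inv ≫ c ◁ ε fstar ≫ c ◁ (adj1.homEquiv _ _).symm n ≫ ε_ c' c
  have hQ : Function.Bijective Q := by
    refine Function.Bijective.comp (g := fun k => (ρ_ c).inv ≫ c ◁ ε fstar ≫ k) ?_
      ((bijective_whiskerLeft_comp_evaluation _ c' c).comp (adj1.homEquiv _ _).symm.bijective)
    exact ⟨fun a b h => (cancel_epi (c ◁ ε fstar)).1 ((cancel_epi _).1 h),
      fun a => ⟨c ◁ η fstar ≫ (ρ_ c).hom ≫ a, by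
        dsimp only
        rw [← MonoidalCategory.whiskerLeft_comp_assoc, Functor.Monoidal.ε_η,
          MonoidalCategory.whiskerLeft_id, Category.id_comp, Iso.inv_hom_id_assoc]⟩⟩
  have h : (fun n => fpush.obj (fone.obj (𝟙_ D) ⊗ c) ◁ n ≫ pushPairing adj1 adj2 c' c) =
      ((fun k => (ρ_ _).hom ≫ k) ∘ (adj2.homEquiv _ _).symm) ∘
        (fun k : c ⟶ 𝟙_ C => fone.obj (𝟙_ D) ◁ k ≫ (ρ_ _).hom) ∘ Q := by
    ext n
    refine whiskerLeft_comp_pushPairing adj1 adj2 c' c n (Q n) ?_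
    simp only [Q, Iso.hom_inv_id_assoc]
    rw [← MonoidalCategory.whiskerLeft_comp_assoc, Functor.Monoidal.η_ε,
      MonoidalCategory.whiskerLeft_id, Category.id_comp]
  rw [h, Function.Bijective.of_comp_iff', Function.Bijective.of_comp_iff _ hQ] at hP
  · exact hP
  · refine Function.Bijective.comp ?_ (Equiv.bijective _)
    exact ⟨fun a b h => (cancel_epi _).1 h, fun a => ⟨(ρ_ _).inv ≫ a, by simp⟩⟩

end

variable {D : Type u₁} {C : Type u₂}
  [Category.{v} D] [Preadditive D] [HasZeroObject D] [HasShift D ℤ]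
  [∀ n : ℤ, (shiftFunctor D n).Additive] [Pretriangulated D]
  [MonoidalCategory D] [SymmetricCategory D] [MonoidalClosed D]
  [Category.{v} C] [Preadditive C] [HasZeroObject C] [HasShift C ℤ]
  [∀ n : ℤ, (shiftFunctor C n).Additive] [Pretriangulated C]
  [MonoidalCategory C] [SymmetricCategory C] [MonoidalClosed C]
  [HasCoproducts.{v} C] [HasCoproducts.{v} D]
  {fstar : D ⥤ C} [fstar.Monoidal]

/-- If the relative dualizing object is compact, then it is invertible. -/
lemma exists_tensor_fone_unit_iso (hD : RigidlyCompactlyGenerated D)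
    (hC : RigidlyCompactlyGenerated C) {fpush : C ⥤ D} (adj1 : fstar ⊣ fpush)
    {fone : D ⥤ C} (adj2 : fpush ⊣ fone)
    {f1 : C ⥤ D} (adj0 : f1 ⊣ fstar) (hf1 : ∀ c, IsCompactObj c → IsCompactObj (f1.obj c))
    (hg : ∀ c, IsCompactObj c → IsCompactObj (fpush.obj c))
    (hω : IsCompactObj (fone.obj (𝟙_ D))) :
    ∃ ω', Nonempty (𝟙_ C ≅ ω' ⊗ fone.obj (𝟙_ D)) := by
  obtain ⟨ω', _, ⟨_⟩⟩ := hC.exists_leftDual hω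
  have : IsIso (η_ ω' (fone.obj (𝟙_ D))) := by
    refine isIso_of_bijective_of_isCompactObj hC.exists_generators _ fun c hc => ?_
    obtain ⟨c', hc', ⟨_⟩⟩ := hC.exists_leftDual hc
    obtain ⟨E, _, ⟨_⟩⟩ := hD.exists_rightDual (hg c' hc')
    rw [← Function.Bijective.of_comp_iff'
      (tensorLeftHomEquiv c ω' (fone.obj (𝟙_ D)) (fone.obj (𝟙_ D))).symm.bijective]
    convert bijective_whiskerLeft_fone_unit adj1 adj2 c' c E
      (isIso_projFormula_of_leftAdjoint hD hC adj1 adj0 hf1 hg hc') using 1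
    ext k
    simp only [Function.comp_apply]
    rw [tensorLeftHomEquiv_symm_naturality]
    congr 1
    simpa using tensorLeftHomEquiv_symm_coevaluation_comp_whiskerLeft
      (Y := ω') (𝟙 (fone.obj (𝟙_ D)))
  exact ⟨ω', ⟨asIso (η_ ω' (fone.obj (𝟙_ D)))⟩⟩

end Invertible

section Tower

/-- Iterated composition of an endofunctor. -/
def iterFunctor {A : Type u₁} [Category.{v} A] (F : A ⥤ A) : ℕ → (A ⥤ A)
  | 0 => 𝟭 A
  | n + 1 => F ⋙ iterFunctor F n

variable {A : Type u₁} [Category.{v} A]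

lemma nonempty_iterFunctor_comp_iso (F : A ⥤ A) (n : ℕ) :
    Nonempty (iterFunctor F n ⋙ F ≅ F ⋙ iterFunctor F n) := by
  induction n with
  | zero => exact ⟨F.leftUnitor ≪≫ F.rightUnitor.symm⟩
  | succ n ih =>
    obtain ⟨e⟩ := ih
    exact ⟨Functor.associator _ _ _ ≪≫ Functor.isoWhiskerLeft F e⟩

lemma nonempty_iterFunctor_adjunction {F G : A ⥤ A} (adj : F ⊣ G) (n : ℕ) :
    Nonempty (iterFunctor F n ⊣ iterFunctor G n) := by
  induction n with
  | zero => exact ⟨Adjunction.id⟩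
  | succ n ih =>
    obtain ⟨a⟩ := ih
    obtain ⟨e⟩ := nonempty_iterFunctor_comp_iso G n
    exact ⟨(adj.comp a).ofNatIsoRight e⟩

/-- Integral powers of an autoequivalence, as functors. -/
def zpowFunctor (E : A ≌ A) : ℤ → (A ⥤ A)
  | Int.ofNat n => iterFunctor E.functor n
  | Int.negSucc n => iterFunctor E.inverse (n + 1)

lemma nonempty_zpowFunctor_adjunction (E : A ≌ A) (n : ℤ) :
    Nonempty (zpowFunctor E n ⊣ zpowFunctor E (-n)) := by
  rcases n with (_ | n) | n
  · exact ⟨Adjunction.id⟩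
  · exact nonempty_iterFunctor_adjunction E.toAdjunction (n + 1)
  · exact nonempty_iterFunctor_adjunction E.symm.toAdjunction (n + 1)

lemma nonempty_comp_zpowFunctor_iso (E : A ≌ A) (n : ℤ) :
    Nonempty (E.functor ⋙ zpowFunctor E n ≅ zpowFunctor E (n + 1)) := by
  rcases n with n | n
  · exact ⟨Iso.refl _⟩
  · have e : E.functor ⋙ zpowFunctor E (Int.negSucc n) ≅ iterFunctor E.inverse n :=
      (Functor.associator _ _ _).symm ≪≫
        Functor.isoWhiskerRight E.unitIso.symm _ ≪≫ Functor.leftUnitor _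
    rcases n with _ | n
    · exact ⟨e⟩
    · exact ⟨e⟩

/-- If the right adjoint of `g` is a twist of its left adjoint by an autoequivalence, then there
is an infinite tower of adjunctions. -/
lemma exists_tower {B : Type u₂} [Category.{v} B] {f : B ⥤ A} {g : A ⥤ B} (adj : f ⊣ g)
    (E : A ≌ A) (adj' : g ⊣ f ⋙ E.functor) :
    ∃ (up : ℤ → (B ⥤ A)) (down : ℤ → (A ⥤ B)), up 0 = f ∧ down 0 = g ∧
      ∀ n : ℤ, Nonempty (up n ⊣ down (-n)) ∧ Nonempty (down (-n) ⊣ up (n + 1)) := by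
  refine ⟨fun n => f ⋙ zpowFunctor E n, fun n => zpowFunctor E n ⋙ g, rfl, rfl, fun n => ?_⟩
  obtain ⟨a⟩ := nonempty_zpowFunctor_adjunction E n
  obtain ⟨b⟩ := nonempty_zpowFunctor_adjunction E (-n)
  rw [neg_neg] at b
  obtain ⟨e⟩ := nonempty_comp_zpowFunctor_iso E n
  exact ⟨⟨adj.comp a⟩, ⟨(b.comp adj').ofNatIsoRight
    (Functor.associator _ _ _ ≪≫ Functor.isoWhiskerLeft f e)⟩⟩

/-- Tensoring with an invertible object is an equivalence. -/
def tensorRightEquivalence [MonoidalCategory A] [BraidedCategory A] (w' w : A)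
    (e : 𝟙_ A ≅ w' ⊗ w) : A ≌ A :=
  CategoryTheory.Equivalence.mk (tensorRight w) (tensorRight w')
    ((rightUnitorNatIso A).symm ≪≫ (tensoringRight A).mapIso (e ≪≫ β_ w' w) ≪≫
      tensorRightTensor w w')
    ((tensorRightTensor w' w).symm ≪≫ (tensoringRight A).mapIso e.symm ≪≫ rightUnitorNatIso A)

end Tower

section Trichotomy

variable {D : Type u₁} {C : Type u₂}
  [Category.{v} D] [Preadditive D] [HasZeroObject D] [HasShift D ℤ]
  [∀ n : ℤ, (shiftFunctor D n).Additive] [Pretriangulated D] [IsTriangulated D]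
  [MonoidalCategory D] [SymmetricCategory D] [MonoidalClosed D]
  [Category.{v} C] [Preadditive C] [HasZeroObject C] [HasShift C ℤ]
  [∀ n : ℤ, (shiftFunctor C n).Additive] [Pretriangulated C] [IsTriangulated C]
  [MonoidalCategory C] [SymmetricCategory C] [MonoidalClosed C]
  {fstar : D ⥤ C} [fstar.Monoidal]

/-- If `f^*` has a left adjoint and the relative dualizing object is compact, then there is an
infinite tower of adjunctions. -/
lemma exists_tower_of_isCompactObj (hD : RigidlyCompactlyGenerated D)
    (hC : RigidlyCompactlyGenerated C) [HasCoproducts.{v} C] [HasCoproducts.{v} D]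
    {fpush : C ⥤ D} (adj1 : fstar ⊣ fpush) {fone : D ⥤ C} (adj2 : fpush ⊣ fone)
    {f1 : C ⥤ D} (adj0 : f1 ⊣ fstar) (hf1 : ∀ c, IsCompactObj c → IsCompactObj (f1.obj c))
    (hg : ∀ c, IsCompactObj c → IsCompactObj (fpush.obj c))
    (hω : IsCompactObj (fone.obj (𝟙_ D))) :
    ∃ (up : ℤ → (D ⥤ C)) (down : ℤ → (C ⥤ D)), up 0 = fstar ∧ down 0 = fpush ∧
      ∀ n : ℤ, Nonempty (up n ⊣ down (-n)) ∧ Nonempty (down (-n) ⊣ up (n + 1)) := by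
  obtain ⟨ω', ⟨e⟩⟩ := exists_tensor_fone_unit_iso hD hC adj1 adj2 adj0 hf1 hg hω
  obtain ⟨t⟩ := nonempty_iso_fone hD hC adj1 adj2 adj0 hf1 hg hω
  exact exists_tower adj1 (tensorRightEquivalence ω' _ e) (adj2.ofNatIsoRight t.symm)

lemma exists_leftAdjoint_of_tower {D : Type u₁} {C : Type u₂} [Category.{v} D] [Category.{v} C]
    {fstar : D ⥤ C} {fpush : C ⥤ D}
    (h : ∃ (up : ℤ → (D ⥤ C)) (down : ℤ → (C ⥤ D)), up 0 = fstar ∧ down 0 = fpush ∧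
      ∀ n : ℤ, Nonempty (up n ⊣ down (-n)) ∧ Nonempty (down (-n) ⊣ up (n + 1))) :
    ∃ f1 : C ⥤ D, Nonempty (f1 ⊣ fstar) ∧ f1.IsRightAdjoint := by
  obtain ⟨up, down, rfl, rfl, h⟩ := h
  obtain ⟨⟨a⟩, ⟨b⟩⟩ := h (-1)
  exact ⟨down 1, ⟨b⟩, a.isRightAdjoint⟩

end Trichotomy

/-- Trichotomy of adjoints, Corollary 1.8. -/
theorem statement11 {D : Type u₁} {C : Type u₂}
    [Category.{v} D] [Preadditive D] [HasZeroObject D] [HasShift D ℤ]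
    [∀ n : ℤ, (shiftFunctor D n).Additive] [Pretriangulated D] [IsTriangulated D]
    [MonoidalCategory D] [SymmetricCategory D] [MonoidalClosed D]
    [Category.{v} C] [Preadditive C] [HasZeroObject C] [HasShift C ℤ]
    [∀ n : ℤ, (shiftFunctor C n).Additive] [Pretriangulated C] [IsTriangulated C]
    [MonoidalCategory C] [SymmetricCategory C] [MonoidalClosed C]
    (fstar : D ⥤ C) [fstar.Braided] [fstar.CommShift ℤ] [fstar.IsTriangulated]
    (hD : RigidlyCompactlyGenerated D) (hC : RigidlyCompactlyGenerated C)
    (hcop : PreservesCoproducts fstar)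
    (fpush : C ⥤ D) (adj1 : fstar ⊣ fpush)
    (fone : D ⥤ C) (adj2 : fpush ⊣ fone) :
    -- exactly one of the three possibilities holds
    (((¬ fstar.IsRightAdjoint ∧ ¬ fone.IsLeftAdjoint) ∨
      ((fstar.IsRightAdjoint ∧ fone.IsLeftAdjoint) ∧
        (∀ f1 : C ⥤ D, Nonempty (f1 ⊣ fstar) → ¬ f1.IsRightAdjoint) ∧
        (∀ fm1 : C ⥤ D, Nonempty (fone ⊣ fm1) → ¬ fm1.IsLeftAdjoint)) ∨
      (∃ (up : ℤ → (D ⥤ C)) (down : ℤ → (C ⥤ D)), up 0 = fstar ∧ down 0 = fpush ∧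
        ∀ n : ℤ, Nonempty (up n ⊣ down (-n)) ∧ Nonempty (down (-n) ⊣ up (n + 1))))) ∧
    ¬ ((¬ fstar.IsRightAdjoint ∧ ¬ fone.IsLeftAdjoint) ∧
      ((fstar.IsRightAdjoint ∧ fone.IsLeftAdjoint) ∧
        (∀ f1 : C ⥤ D, Nonempty (f1 ⊣ fstar) → ¬ f1.IsRightAdjoint) ∧
        (∀ fm1 : C ⥤ D, Nonempty (fone ⊣ fm1) → ¬ fm1.IsLeftAdjoint))) ∧
    ¬ ((¬ fstar.IsRightAdjoint ∧ ¬ fone.IsLeftAdjoint) ∧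
      (∃ (up : ℤ → (D ⥤ C)) (down : ℤ → (C ⥤ D)), up 0 = fstar ∧ down 0 = fpush ∧
        ∀ n : ℤ, Nonempty (up n ⊣ down (-n)) ∧ Nonempty (down (-n) ⊣ up (n + 1)))) ∧
    ¬ (((fstar.IsRightAdjoint ∧ fone.IsLeftAdjoint) ∧
        (∀ f1 : C ⥤ D, Nonempty (f1 ⊣ fstar) → ¬ f1.IsRightAdjoint) ∧
        (∀ fm1 : C ⥤ D, Nonempty (fone ⊣ fm1) → ¬ fm1.IsLeftAdjoint)) ∧
      (∃ (up : ℤ → (D ⥤ C)) (down : ℤ → (C ⥤ D)), up 0 = fstar ∧ down 0 = fpush ∧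
        ∀ n : ℤ, Nonempty (up n ⊣ down (-n)) ∧ Nonempty (down (-n) ⊣ up (n + 1)))) := by
  have := hD.hasCoproducts
  have := hC.hasCoproducts
  let := adj1.rightAdjointCommShift ℤ
  have := adj1.commShift_of_leftAdjoint ℤ
  have := adj1.isTriangulated_rightAdjoint
  let := adj2.rightAdjointCommShift ℤ
  have := adj2.commShift_of_leftAdjoint ℤ
  have := adj2.isTriangulated_rightAdjoint
  have hPQ : fone.IsLeftAdjoint → fstar.IsRightAdjoint := fun h =>
    isRightAdjoint_of_isCompactObj_map hD hC hcop adj1 fun c hc =>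
      IsCompactObj.of_adjunction adj2 (preservesCoproducts_of_isLeftAdjoint fone) hc
  have hf1 {f1 : C ⥤ D} (adj0 : f1 ⊣ fstar) (c : C) (hc : IsCompactObj c) :
      IsCompactObj (f1.obj c) := IsCompactObj.of_adjunction adj0 hcop hc
  have hg {f1 : C ⥤ D} (adj0 : f1 ⊣ fstar) (c : C) (hc : IsCompactObj c) :
      IsCompactObj (fpush.obj c) :=
    isCompactObj_map_of_leftAdjoint hD hC adj1 adj0 (hf1 adj0) hc
  have hQP : fstar.IsRightAdjoint → fone.IsLeftAdjoint := fun h =>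
    isLeftAdjoint_of_preservesCoproducts fone hD.exists_generators
      (preservesCoproducts_of_adjunction hC.exists_generators adj2
        (hg (Adjunction.ofIsRightAdjoint fstar)))
  have htower {f1 : C ⥤ D} (adj0 : f1 ⊣ fstar) (hω : IsCompactObj (fone.obj (𝟙_ D))) :=
    exists_tower_of_isCompactObj hD hC adj1 adj2 adj0 (hf1 adj0) (hg adj0) hω
  have hleft {f1 : C ⥤ D} (adj0 : f1 ⊣ fstar) (h : f1.IsRightAdjoint) :
      IsCompactObj (fone.obj (𝟙_ D)) := by
    have := adj0.isLeftAdjoint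
    have : f1.Additive := adj0.left_adjoint_additive
    exact isCompactObj_fone_unit_of_leftAdjoint hD hC adj1 adj2 adj0
      (Adjunction.ofIsRightAdjoint f1)
      (IsCompactObj.of_adjunction (Adjunction.ofIsRightAdjoint f1)
        (preservesCoproducts_of_isLeftAdjoint f1) hD.isCompactObj_unit) (hf1 adj0) (hg adj0)
  have hright {fm1 : C ⥤ D} (adj3 : fone ⊣ fm1) (h : fm1.IsLeftAdjoint) :
      IsCompactObj (fone.obj (𝟙_ D)) := by
    have : fm1.Additive := adj3.right_adjoint_additive
    exact IsCompactObj.of_adjunction adj3 (preservesCoproducts_of_isLeftAdjoint fm1)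
      hD.isCompactObj_unit
  refine ⟨?_, fun h => h.1.1 h.2.1.1, fun h => ?_, fun h => ?_⟩
  · by_cases hP : fstar.IsRightAdjoint
    · refine Or.inr ?_
      by_cases hω : IsCompactObj (fone.obj (𝟙_ D))
      · exact Or.inr (htower (Adjunction.ofIsRightAdjoint fstar) hω)
      · exact Or.inl ⟨⟨hP, hQP hP⟩, fun f1 ⟨adj0⟩ h => hω (hleft adj0 h),
          fun fm1 ⟨adj3⟩ h => hω (hright adj3 h)⟩
    · exact Or.inl ⟨hP, fun h => hP (hPQ h)⟩
  · obtain ⟨f1, ⟨adj0⟩, -⟩ := exists_leftAdjoint_of_tower h.2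
    exact h.1.1 adj0.isRightAdjoint
  · obtain ⟨f1, hf1, h'⟩ := exists_leftAdjoint_of_tower h.2
    exact h.1.2.1 f1 hf1 h'

end GN
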